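/- arXiv:1904.01358 — 2 statements merged into one kernel-verified Lean document; each statement's English description precedes it below -/
import Mathlib

section
/- For every partition λ with at most n parts, the Schur polynomial s_λ(x_1,…,x_n) is the Schubert polynomial 𝔖_{π_λ}, where π_λ is the unique permutation whose Lehmer code is the weak composition obtained by padding λ to length n with zeros and reversing; equivalently, π_λ(i) = λ_{n−i+1} + i for i ≤ n, and for i > n, π_λ(i) is the smallest positive integer not among π_λ(1),…,π_λ(i−1). -/
open MvPolynomial

/-- `S` is the family of Schubert polynomials for `S_N` (in the 1-indexed variables
`x_1, …, x_N`, position `i : Fin N` corresponding to `x_{i+1}`):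
`S(w_0) = x_1^{N-1} ⋯ x_N^0`, and whenever `w(i) < w(i+1)`,
`(x_i - x_{i+1}) ⬝ S w = S (w s_i) - s_i ⬝ S (w s_i)`. -/
def SchubertFamily (N : ℕ) (S : Equiv.Perm (Fin N) → MvPolynomial ℕ ℤ) : Prop :=
  S Fin.revPerm = (∏ i : Fin N, X ((i : ℕ) + 1) ^ (N - 1 - (i : ℕ))) ∧
  ∀ (w : Equiv.Perm (Fin N)) (i : Fin N) (h : (i : ℕ) + 1 < N),
    w i < w ⟨(i : ℕ) + 1, h⟩ →
    (X ((i : ℕ) + 1) - X ((i : ℕ) + 2)) * S w =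
      S (w * Equiv.swap i ⟨(i : ℕ) + 1, h⟩) -
        rename (Equiv.swap ((i : ℕ) + 1) ((i : ℕ) + 2))
          (S (w * Equiv.swap i ⟨(i : ℕ) + 1, h⟩))

/-- Semistandard Young tableaux of shape `lam` with entries in `{1, …, n}`. -/
structure SSYT (lam : ℕ → ℕ) (n : ℕ) where
  entry : ℕ → ℕ → ℕ
  pos : ∀ i j, j < lam i → 1 ≤ entry i j ∧ entry i j ≤ n
  zero : ∀ i j, ¬ j < lam i → entry i j = 0
  rowWeak : ∀ i j j', j ≤ j' → j' < lam i → entry i j ≤ entry i j'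
  colStrict : ∀ i i' j, i < i' → j < lam i → j < lam i' → entry i j < entry i' j

/-- The weight of a tableau: `T.wt k` is the number of boxes labelled `k`. -/
noncomputable def SSYT.wt {lam : ℕ → ℕ} {n : ℕ} (T : SSYT lam n) (k : ℕ) : ℕ :=
  {p : ℕ × ℕ | p.2 < lam p.1 ∧ T.entry p.1 p.2 = k}.ncard

/-- The Schur polynomial `s_λ(x_1, …, x_n)` in the 1-indexed variables `x_1, x_2, …`:
the generating function of semistandard Young tableaux of shape `λ` with entries in
`{1, …, n}`. -/
noncomputable def schurN (n : ℕ) (lam : ℕ → ℕ) : MvPolynomial ℕ ℤ :=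
  ∑ᶠ T : SSYT lam n, ∏ k ∈ Finset.range n, X (k + 1) ^ T.wt (k + 1)


namespace SchurSchubert

/-- number of later positions (before `n`) with a larger value -/
def E {N : ℕ} (n : ℕ) (w : Equiv.Perm (Fin N)) (i : Fin N) : ℕ :=
  (Finset.univ.filter fun j : Fin N => i < j ∧ (j : ℕ) < n ∧ w i < w j).card

/-- 132-avoidance on the first `n` positions -/
def Av {N : ℕ} (n : ℕ) (w : Equiv.Perm (Fin N)) : Prop :=
  ∀ a b c : Fin N, a < b → b < c → (c : ℕ) < n → w a < w c → w c < w b → False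

lemma desc_of_adj {N : ℕ} (w : Equiv.Perm (Fin N)) (m : ℕ)
    (H : ∀ i (h : i + 1 < N), i + 1 < m → ¬ w ⟨i, by omega⟩ < w ⟨i + 1, h⟩) :
    ∀ a b : Fin N, a < b → (b : ℕ) < m → w b < w a := by
  intro a b hab hb
  obtain ⟨a, ha⟩ := a
  obtain ⟨b, hb'⟩ := b
  simp only [Fin.mk_lt_mk] at hab
  simp only at hb
  induction b with
  | zero => omega
  | succ b ih =>
    have h1 := H b hb' hb
    have h2 : w ⟨b, by omega⟩ ≠ w ⟨b + 1, hb'⟩ := by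
      intro h
      have := w.injective h
      simp at this
    have h3 : w ⟨b + 1, hb'⟩ < w ⟨b, by omega⟩ := lt_of_le_of_ne (not_lt.mp h1) (Ne.symm h2)
    rcases Nat.lt_or_ge a b with h | h
    · exact h3.trans (ih (by omega) (by omega) (by omega))
    · have : a = b := by omega
      subst this
      exact h3

lemma E_step {N n : ℕ} (w : Equiv.Perm (Fin N)) (hw : Av n w) (i i' : Fin N)
    (h : (i' : ℕ) = i + 1) (hn : (i' : ℕ) < n) (hlt : w i < w i') :
    (∀ k, E n w k = E n (w * Equiv.swap i i') k + if k = i then 1 else 0) ∧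
    E n (w * Equiv.swap i i') i = E n (w * Equiv.swap i i') i' := by
  have hne : i ≠ i' := by intro h'; rw [h'] at h; omega
  have sw : ∀ j, j ≠ i → j ≠ i' → Equiv.swap i i' j = j := fun j h1 h2 =>
    Equiv.swap_apply_of_ne_of_ne h1 h2
  have e1 : E n (w * Equiv.swap i i') i = E n w i' := by
    unfold E
    congr 1
    ext j
    simp only [Finset.mem_filter, Finset.mem_univ, true_and, Equiv.Perm.mul_apply,
      Equiv.swap_apply_left]
    by_cases h1 : j = i
    · subst h1; simp only [Fin.lt_def] at *; omega
    by_cases h2 : j = i'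
    · subst h2; simp only [Equiv.swap_apply_right, Fin.lt_def] at *; omega
    rw [sw j h1 h2]
    simp only [Fin.lt_def, Fin.ext_iff] at *; omega
  have e2 : E n (w * Equiv.swap i i') i' = E n w i' := by
    unfold E
    congr 1
    ext j
    simp only [Finset.mem_filter, Finset.mem_univ, true_and, Equiv.Perm.mul_apply,
      Equiv.swap_apply_right]
    by_cases h1 : j = i
    · subst h1; simp only [Fin.lt_def] at *; omega
    by_cases h2 : j = i'
    · subst h2; simp
    rw [sw j h1 h2]
    constructor
    · rintro ⟨a, b, c⟩
      refine ⟨a, b, ?_⟩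
      by_contra h3
      have h4 : w j ≠ w i' := fun h => h2 (w.injective h)
      exact hw i i' j (by simp only [Fin.lt_def]; omega) a b c
        (lt_of_le_of_ne (not_lt.mp h3) h4)
    · rintro ⟨a, b, c⟩
      exact ⟨a, b, hlt.trans c⟩
  have e3 : E n w i = E n w i' + 1 := by
    unfold E
    rw [← Finset.card_insert_of_notMem (a := i')]
    · congr 1
      ext j
      simp only [Finset.mem_filter, Finset.mem_univ, true_and, Finset.mem_insert]
      constructor
      · rintro ⟨a, b, c⟩
        by_cases h2 : j = i'
        · exact Or.inl h2
        right
        have a' : i' < j := by simp only [Fin.lt_def, Fin.ext_iff] at *; omega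
        refine ⟨a', b, ?_⟩
        by_contra h3
        have h4 : w j ≠ w i' := fun h => h2 (w.injective h)
        exact hw i i' j (by simp only [Fin.lt_def]; omega) a' b c
          (lt_of_le_of_ne (not_lt.mp h3) h4)
      · rintro (rfl | ⟨a, b, c⟩)
        · exact ⟨by simp only [Fin.lt_def]; omega, hn, hlt⟩
        · exact ⟨by simp only [Fin.lt_def] at *; omega, b, hlt.trans c⟩
    · simp
  refine ⟨?_, by rw [e1, e2]⟩
  intro k
  by_cases hk : k = i
  · subst hk; simp [e1, e3]
  by_cases hk' : k = i'
  · subst hk'; simp [e2, hk]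
  simp only [hk, if_false, add_zero]
  unfold E
  apply Finset.card_equiv (Equiv.swap i i')
  intro j
  simp only [Finset.mem_filter, Finset.mem_univ, true_and, Equiv.Perm.mul_apply,
    Equiv.swap_apply_self, sw k hk hk']
  by_cases h1 : j = i
  · subst h1; simp only [Equiv.swap_apply_left, Fin.lt_def, Fin.ext_iff] at *; omega
  by_cases h2 : j = i'
  · subst h2; simp only [Equiv.swap_apply_right, Fin.lt_def, Fin.ext_iff] at *; omega
  rw [sw j h1 h2]

lemma Av_step {N n : ℕ} (w : Equiv.Perm (Fin N)) (hw : Av n w) (i i' : Fin N)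
    (h : (i' : ℕ) = i + 1) (hlt : w i < w i') (hdec : ∀ a, a < i → w i < w a)
    (hn : (i' : ℕ) < n) :
    Av n (w * Equiv.swap i i') := by
  intro a b c hab hbc hc h1 h2
  simp only [Equiv.Perm.mul_apply] at h1 h2
  have hne : i ≠ i' := by intro h'; rw [h'] at h; omega
  have sw : ∀ j, j ≠ i → j ≠ i' → Equiv.swap i i' j = j := fun j h1 h2 =>
    Equiv.swap_apply_of_ne_of_ne h1 h2
  have key : ∀ x y : Fin N, x < y → ¬ (x = i ∧ y = i') →
      Equiv.swap i i' x < Equiv.swap i i' y := by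
    intro x y hxy hh
    by_cases x1 : x = i
    · subst x1
      have y1 : y ≠ x := by rintro rfl; simp at hxy
      have y2 : y ≠ i' := fun h => hh ⟨rfl, h⟩
      rw [sw y y1 y2, Equiv.swap_apply_left]
      simp only [Fin.lt_def, Fin.ext_iff, ne_eq] at *; omega
    by_cases x2 : x = i'
    · subst x2
      have y1 : y ≠ x := by rintro rfl; simp at hxy
      have y2 : y ≠ i := by rintro rfl; simp only [Fin.lt_def] at *; omega
      rw [sw y y2 y1, Equiv.swap_apply_right]
      simp only [Fin.lt_def, Fin.ext_iff, ne_eq] at *; omega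
    rw [sw x x1 x2]
    by_cases y1 : y = i
    · subst y1
      rw [Equiv.swap_apply_left]
      simp only [Fin.lt_def, Fin.ext_iff, ne_eq] at *; omega
    by_cases y2 : y = i'
    · subst y2
      rw [Equiv.swap_apply_right]
      simp only [Fin.lt_def, Fin.ext_iff, ne_eq] at *; omega
    rw [sw y y1 y2]; exact hxy
  have hc' : ((Equiv.swap i i' c : Fin N) : ℕ) < n := by
    rcases Equiv.swap_apply_eq_iff.mp (rfl : Equiv.swap i i' c = _) with _
    by_cases y1 : c = i
    · subst y1; rw [Equiv.swap_apply_left]; exact hn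
    by_cases y2 : c = i'
    · subst y2; rw [Equiv.swap_apply_right]; omega
    rw [sw c y1 y2]; exact hc
  by_cases q1 : a = i ∧ b = i'
  · obtain ⟨rfl, rfl⟩ := q1
    rw [Equiv.swap_apply_left] at h1
    rw [Equiv.swap_apply_right] at h2
    exact absurd (h1.trans h2) (not_lt.mpr hlt.le)
  by_cases q2 : b = i ∧ c = i'
  · obtain ⟨rfl, rfl⟩ := q2
    rw [Equiv.swap_apply_right, sw a hab.ne (hab.trans hbc).ne] at h1
    exact absurd (hdec a hab) (not_lt.mpr h1.le)
  exact hw _ _ _ (key a b hab q1) (key b c hbc q2) hc' h1 h2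

lemma dom_induct {N n : ℕ} (P : Equiv.Perm (Fin N) → Prop)
    (top : ∀ w : Equiv.Perm (Fin N), (∀ a b : Fin N, a < b → (b : ℕ) < n → w b < w a) → P w)
    (step : ∀ (w : Equiv.Perm (Fin N)) (i : Fin N) (h : (i : ℕ) + 1 < N), (i : ℕ) + 1 < n →
      w i < w ⟨i + 1, h⟩ →
      (∀ k, E n w k = E n (w * Equiv.swap i ⟨i + 1, h⟩) k + if k = i then 1 else 0) →
      E n (w * Equiv.swap i ⟨i + 1, h⟩) i = E n (w * Equiv.swap i ⟨i + 1, h⟩) ⟨i + 1, h⟩ →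
      P (w * Equiv.swap i ⟨i + 1, h⟩) → P w) :
    ∀ w, Av n w → P w := by
  intro w
  induction hs : ∑ k, E n w k using Nat.strong_induction_on generalizing w with
  | _ s ih =>
  intro hw
  by_cases hex : ∃ i, ∃ h : i + 1 < N, i + 1 < n ∧ w ⟨i, by omega⟩ < w ⟨i + 1, h⟩
  · classical
    obtain ⟨h, hn, hlt⟩ := Nat.find_spec hex
    have hmin := fun m (hm : m < Nat.find hex) => Nat.find_min hex hm
    set i := Nat.find hex
    have hdec := desc_of_adj w (i + 1) (fun k hk hk' hh =>
      hmin k (by omega) ⟨hk, by omega, hh⟩)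
    obtain ⟨s1, s2⟩ := E_step w hw ⟨i, by omega⟩ ⟨i + 1, h⟩ rfl hn hlt
    refine step w ⟨i, by omega⟩ h hn hlt s1 s2 ?_
    refine ih _ ?_ _ rfl (Av_step w hw _ _ rfl hlt (fun a ha => hdec a _ ha (by simp)) hn)
    rw [← hs, Finset.sum_congr rfl (fun k _ => s1 k), Finset.sum_add_distrib]
    simp
  · apply top
    apply desc_of_adj
    intro i h hn hlt
    exact hex ⟨i, h, hn, hlt⟩

/-- monomials in the first `N` variables -/
noncomputable def mon {N : ℕ} (e : Fin N → ℕ) : MvPolynomial ℕ ℤ :=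
  ∏ k : Fin N, X ((k : ℕ) + 1) ^ e k

lemma mon_add_one {N : ℕ} (e e' : Fin N → ℕ) (i : Fin N)
    (h : ∀ k, e k = e' k + if k = i then 1 else 0) : mon e = X ((i : ℕ) + 1) * mon e' := by
  unfold mon
  simp only [h, pow_add, Finset.prod_mul_distrib]
  rw [mul_comm]
  congr 1
  rw [Finset.prod_eq_single i]
  · simp
  · intro b _ hb; simp [hb]
  · simp

lemma swap_succ {N : ℕ} (i i' k : Fin N) :
    Equiv.swap ((i : ℕ) + 1) ((i' : ℕ) + 1) ((k : ℕ) + 1) = (Equiv.swap i i' k : ℕ) + 1 := by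
  simp only [Equiv.swap_apply_def, Fin.ext_iff, Nat.add_right_cancel_iff]
  split_ifs <;> rfl

lemma rename_mon {N : ℕ} (e : Fin N → ℕ) (i i' : Fin N) (h : e i = e i') :
    rename (Equiv.swap ((i : ℕ) + 1) ((i' : ℕ) + 1)) (mon e) = mon e := by
  unfold mon
  rw [map_prod]
  apply Fintype.prod_equiv (Equiv.swap i i')
  intro k
  rw [map_pow, rename_X, swap_succ]
  congr 1
  rw [Equiv.swap_apply_def]
  split_ifs with h1 h2
  · rw [h1, h]
  · rw [h2, h]
  · rfl

lemma X_sub_ne (a b : ℕ) (h : a ≠ b) : (X a - X b : MvPolynomial ℕ ℤ) ≠ 0 := by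
  rw [sub_ne_zero]
  intro h'
  exact h (X_injective h')

lemma mon_ne {N : ℕ} (e : Fin N → ℕ) : mon e ≠ 0 := by
  unfold mon
  exact Finset.prod_ne_zero_iff.mpr fun k _ => pow_ne_zero _ (X_ne_zero _)

lemma dominant {N : ℕ} {S : Equiv.Perm (Fin N) → MvPolynomial ℕ ℤ} (hS : SchubertFamily N S) :
    ∀ w, Av N w → mon (E N w) * S w = mon (fun k : Fin N => N - 1 - (k : ℕ)) := by
  apply dom_induct
  · intro w hw
    have hE : ∀ k, E N w k = 0 := by
      intro k
      unfold E
      rw [Finset.card_eq_zero, Finset.filter_eq_empty_iff]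
      rintro j - ⟨h1, h2, h3⟩
      exact absurd (hw k j h1 j.2) (not_lt.mpr h3.le)
    have hrev : w = Fin.revPerm := by
      have h1 : StrictMono (fun k => w (Fin.rev k)) := by
        intro a b hab
        exact hw _ _ (Fin.rev_lt_rev.mpr hab) (Fin.is_lt _)
      have h2 : (fun k => w (Fin.rev k)) = id := by
        apply (h1.range_inj strictMono_id).mp
        rw [Set.range_id, Set.range_eq_univ]
        exact w.surjective.comp Fin.rev_surjective
      ext k
      have := congrFun h2 (Fin.rev k)
      simp only [Fin.rev_rev, id] at this
      rw [this]; rfl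
    have : mon (E N w) = 1 := by simp [mon, hE]
    rw [this, one_mul, hrev, hS.1]
    rfl
  · intro w i h _ hlt hE1 hE2 IH
    have hs := hS.2 w i h hlt
    set w' := w * Equiv.swap i ⟨i + 1, h⟩
    set d' : Fin N → ℕ := fun k => N - 1 - (k : ℕ) - if k = i then 1 else 0 with hd'
    have hd : mon (fun k : Fin N => N - 1 - (k : ℕ)) = X ((i : ℕ) + 1) * mon d' := by
      apply mon_add_one
      intro k
      simp only [hd']
      split_ifs with hk
      · subst hk; omega
      · omega
    have r1 := rename_mon d' i ⟨i + 1, h⟩ (by simp [hd', Fin.ext_iff]; omega)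
    have r2 := rename_mon (E N w') i ⟨i + 1, h⟩ hE2
    have r3 := congrArg (rename (Equiv.swap ((i : ℕ) + 1) ((i : ℕ) + 2))) IH
    rw [hd, map_mul, map_mul, rename_X, Equiv.swap_apply_left] at r3
    simp only [add_assoc, Nat.reduceAdd] at r1 r2
    rw [r1, r2] at r3
    rw [mon_add_one _ _ i hE1, hd, mul_assoc]
    congr 1
    apply mul_left_cancel₀ (X_sub_ne ((i : ℕ) + 1) ((i : ℕ) + 2) (by omega))
    rw [hd] at IH
    linear_combination mon (E N w') * hs + IH - r3


/-- the alternant -/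
noncomputable def D (n : ℕ) (lam : ℕ → ℕ) : MvPolynomial ℕ ℤ :=
  Matrix.det (Matrix.of fun i j : Fin n =>
    (X ((i : ℕ) + 1) : MvPolynomial ℕ ℤ) ^ (lam j + (n - 1 - (j : ℕ))))

/-- extension by zero -/
def ext {n : ℕ} (m : Fin n → ℕ) (i : ℕ) : ℕ := if h : i < n then m ⟨i, h⟩ else 0

/-- interlacing vectors -/
def inter (n : ℕ) (lam : ℕ → ℕ) : Finset (Fin n → ℕ) :=
  Fintype.piFinset fun j : Fin n => Finset.Icc (lam (j + 1)) (lam j)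

lemma det_col_succ {n : ℕ} {R : Type*} [CommRing R] {A B : Matrix (Fin (n + 1)) (Fin (n + 1)) R}
    (c : Fin n → R) (h0 : ∀ i, A i (Fin.last n) = B i (Fin.last n))
    (hs : ∀ i j, A i (Fin.castSucc j) = B i (Fin.castSucc j) + c j * A i (Fin.succ j)) :
    A.det = B.det := by
  rw [← Matrix.det_submatrix_equiv_self Fin.revPerm A,
    ← Matrix.det_submatrix_equiv_self Fin.revPerm B]
  apply Matrix.det_eq_of_forall_col_eq_smul_add_pred (fun j => c (Fin.rev j))
  · intro i
    simp [h0]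
  · intro i j
    simp only [Matrix.submatrix_apply, Fin.revPerm_apply, Fin.rev_succ, Fin.rev_castSucc]
    exact hs _ _

lemma geom (x y : MvPolynomial ℕ ℤ) (a b c : ℕ) (h : b ≤ a) :
    (x - y) * ∑ k ∈ Finset.Icc b a, x ^ (k + c) * y ^ (a - k)
      = x ^ (a + c + 1) - y ^ (a - b + 1) * x ^ (b + c) := by
  obtain ⟨d, rfl⟩ := Nat.exists_eq_add_of_le h
  induction d with
  | zero => simp; ring
  | succ d ih =>
    have : ∑ k ∈ Finset.Icc b (b + (d + 1)), x ^ (k + c) * y ^ (b + (d + 1) - k)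
        = y * (∑ k ∈ Finset.Icc b (b + d), x ^ (k + c) * y ^ (b + d - k))
          + x ^ (b + (d + 1) + c) := by
      rw [← add_assoc, Finset.sum_Icc_succ_top (by omega), Finset.mul_sum]
      congr 1
      · apply Finset.sum_congr rfl
        intro k hk
        rw [Finset.mem_Icc] at hk
        rw [show b + d + 1 - k = (b + d - k) + 1 by omega]
        ring
      · simp
    rw [this]
    have ih' := ih (by omega)
    rw [show b + d - b = d by omega] at ih'
    rw [show b + (d + 1) - b = d + 1 by omega]
    linear_combination y * ih'

lemma D_branch (n : ℕ) (lam : ℕ → ℕ) (hdec : ∀ i j, i ≤ j → lam j ≤ lam i) :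
    D (n + 1) lam = (∏ i : Fin n, (X ((i : ℕ) + 1) - X (n + 1))) *
      ∑ m ∈ inter n lam, X (n + 1) ^ (lam n + ∑ j : Fin n, (lam j - m j)) * D n (ext m) := by
  set y : MvPolynomial ℕ ℤ := X (n + 1) with hy
  let B : Matrix (Fin (n + 1)) (Fin (n + 1)) (MvPolynomial ℕ ℤ) := Matrix.of fun i j =>
    if (j : ℕ) = n then X ((i : ℕ) + 1) ^ lam n
    else (X ((i : ℕ) + 1) - y) * ∑ k ∈ Finset.Icc (lam (j + 1)) (lam j),
      X ((i : ℕ) + 1) ^ (k + (n - 1 - (j : ℕ))) * y ^ (lam j - k)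
  have h1 : D (n + 1) lam = B.det := by
    apply det_col_succ (fun j : Fin n => y ^ (lam j - lam (j + 1) + 1))
    · intro i
      simp [B]
    · intro i j
      have hj := j.2
      simp only [B, Matrix.of_apply, Fin.val_castSucc, Fin.val_succ, hj.ne, if_false]
      rw [geom _ _ _ _ _ (hdec _ _ (by omega))]
      rw [show n + 1 - 1 - ((j : ℕ) + 1) = n - 1 - j by omega,
        show lam j + (n + 1 - 1 - (j : ℕ)) = lam j + (n - 1 - j) + 1 by omega]
      ring
  have h2 : B.det = y ^ lam n * (Matrix.of fun i j : Fin n =>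
      (X ((i : ℕ) + 1) - y) * ∑ k ∈ Finset.Icc (lam (j + 1)) (lam j),
      X ((i : ℕ) + 1) ^ (k + (n - 1 - (j : ℕ))) * y ^ (lam j - k)).det := by
    rw [Matrix.det_succ_row B (Fin.last n), Fin.sum_univ_castSucc]
    have : ∀ j : Fin n, B (Fin.last n) (Fin.castSucc j) = 0 := by
      intro j
      simp [B, j.2.ne, hy]
    simp only [this, mul_zero, zero_mul, Finset.sum_const_zero, zero_add]
    have e : (-1 : MvPolynomial ℕ ℤ) ^ ((Fin.last n : Fin (n+1)) + (Fin.last n : Fin (n + 1)) : ℕ) = 1 := by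
      simp [← two_mul, pow_mul]
    rw [e]
    congr 1
    · simp [B, hy]
    · congr 1
      ext1 i j
      simp [B, j.2.ne]
  have h3 := Matrix.det_mul_column (fun i : Fin n => (X ((i : ℕ) + 1) - y))
    (Matrix.of fun i j : Fin n => ∑ k ∈ Finset.Icc (lam (j + 1)) (lam j),
      X ((i : ℕ) + 1) ^ (k + (n - 1 - (j : ℕ))) * y ^ (lam j - k))
  simp only [Matrix.of_apply] at h3
  rw [h1, h2, h3, mul_left_comm]
  congr 1
  have h4 : (Matrix.of fun i j : Fin n => ∑ k ∈ Finset.Icc (lam (j + 1)) (lam j),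
      (X ((i : ℕ) + 1) : MvPolynomial ℕ ℤ) ^ (k + (n - 1 - (j : ℕ))) * y ^ (lam j - k)).det
      = ∑ m ∈ inter n lam, (Matrix.of fun i j : Fin n =>
        y ^ (lam j - m j) * X ((i : ℕ) + 1) ^ (m j + (n - 1 - (j : ℕ)))).det := by
    rw [← Matrix.det_transpose]
    have := (Matrix.detRowAlternating (n := Fin n)
      (R := MvPolynomial ℕ ℤ)).toMultilinearMap.map_sum_finset
      (fun (j : Fin n) (k : ℕ) (i : Fin n) =>
        y ^ (lam j - k) * X ((i : ℕ) + 1) ^ (k + (n - 1 - (j : ℕ))))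
      (fun j : Fin n => Finset.Icc (lam (j + 1)) (lam j))
    refine Eq.trans ?_ (this.trans ?_)
    · congr 1
      ext1 j i
      simp [Finset.sum_apply, mul_comm]
    · apply Finset.sum_congr rfl
      intro m _
      rw [← Matrix.det_transpose]
      rfl
  rw [h4, Finset.mul_sum]
  apply Finset.sum_congr rfl
  intro m _
  have h5 := Matrix.det_mul_row (fun j : Fin n => y ^ (lam j - m j))
    (Matrix.of fun i j : Fin n => (X ((i : ℕ) + 1) : MvPolynomial ℕ ℤ) ^ (m j + (n - 1 - (j : ℕ))))
  simp only [Matrix.of_apply] at h5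
  rw [h5, pow_add, ← Finset.prod_pow_eq_pow_sum, mul_assoc]
  congr 2
  unfold D ext
  simp

lemma D_zero_succ (n : ℕ) :
    D (n + 1) (fun _ => 0) = (∏ i : Fin n, (X ((i : ℕ) + 1) - X (n + 1))) * D n (fun _ => 0) := by
  rw [D_branch n _ (fun _ _ _ => le_rfl)]
  congr 1
  have : inter n (fun _ => 0) = {fun _ => 0} := by
    ext m
    simp [inter, funext_iff]
  rw [this, Finset.sum_singleton]
  have h : (ext fun _ : Fin n => 0) = fun _ => 0 := by
    funext i; simp [ext]
  rw [h]
  simp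

lemma D_zero_ne (n : ℕ) : D n (fun _ => 0) ≠ 0 := by
  induction n with
  | zero => simp [D]
  | succ n ih =>
    rw [D_zero_succ]
    refine mul_ne_zero (Finset.prod_ne_zero_iff.mpr fun i _ => X_sub_ne _ _ ?_) ih
    have := i.2
    omega


lemma ext_of_lt {n : ℕ} (m : Fin n → ℕ) (i : ℕ) (h : i < n) : ext m i = m ⟨i, h⟩ := by
  simp [ext, h]

lemma ext_of_ge {n : ℕ} (m : Fin n → ℕ) (i : ℕ) (h : n ≤ i) : ext m i = 0 := by
  simp [ext, not_lt.mpr h]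

lemma inter_le {n : ℕ} {lam : ℕ → ℕ} {m : Fin n → ℕ} (hm : m ∈ inter n lam) (i : ℕ) :
    ext m i ≤ lam i := by
  rw [inter, Fintype.mem_piFinset] at hm
  rcases lt_or_ge i n with h | h
  · rw [ext_of_lt m i h]; exact (Finset.mem_Icc.mp (hm ⟨i, h⟩)).2
  · rw [ext_of_ge m i h]; exact Nat.zero_le _

lemma le_inter {n : ℕ} {lam : ℕ → ℕ} {m : Fin n → ℕ} (hm : m ∈ inter n lam)
    (hsupp : ∀ i, n + 1 ≤ i → lam i = 0) (i : ℕ) : lam (i + 1) ≤ ext m i := by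
  rw [inter, Fintype.mem_piFinset] at hm
  rcases lt_or_ge i n with h | h
  · rw [ext_of_lt m i h]; exact (Finset.mem_Icc.mp (hm ⟨i, h⟩)).1
  · rw [hsupp _ (by omega)]; exact Nat.zero_le _

lemma ext_dec {n : ℕ} {lam : ℕ → ℕ} {m : Fin n → ℕ} (hm : m ∈ inter n lam)
    (hdec : ∀ i j, i ≤ j → lam j ≤ lam i)
    (hsupp : ∀ i, n + 1 ≤ i → lam i = 0) (i j : ℕ) (hij : i ≤ j) : ext m j ≤ ext m i := by
  rcases hij.eq_or_lt with rfl | h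
  · exact le_rfl
  · exact (inter_le hm j).trans ((hdec (i + 1) j h).trans (le_inter hm hsupp i))

lemma SSYT_ext {lam : ℕ → ℕ} {n : ℕ} {T T' : SSYT lam n} (h : T.entry = T'.entry) : T = T' := by
  cases T; cases T'; cases h; rfl

/-- add the boxes labelled `n + 1` -/
def glue {n : ℕ} {lam : ℕ → ℕ} (hdec : ∀ i j, i ≤ j → lam j ≤ lam i)
    (hsupp : ∀ i, n + 1 ≤ i → lam i = 0)
    (p : Σ m : {m // m ∈ inter n lam}, SSYT (ext m.1) n) : SSYT lam (n + 1) where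
  entry i j := if j < ext p.1.1 i then p.2.entry i j else if j < lam i then n + 1 else 0
  pos i j h := by
    split_ifs with h1
    · have := p.2.pos i j h1; omega
    · omega
  zero i j h := by
    have := inter_le p.1.2 i
    rw [if_neg (by omega), if_neg h]
  rowWeak i j j' hjj h := by
    split_ifs with h1 h2 h2 <;> try omega
    · exact p.2.rowWeak i j j' hjj h2
    · have := (p.2.pos i j h1).2; omega
  colStrict i i' j hii h h' := by
    have h1 : j < ext p.1.1 i := by
      have := le_inter p.1.2 hsupp i
      have := hdec (i + 1) i' hii
      omega
    rw [if_pos h1]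
    split_ifs with h2
    · exact p.2.colStrict i i' j hii h1 h2
    · have := (p.2.pos i j h1).2; omega

lemma glue_le {n : ℕ} {lam : ℕ → ℕ} (hdec : ∀ i j, i ≤ j → lam j ≤ lam i)
    (hsupp : ∀ i, n + 1 ≤ i → lam i = 0)
    (p : Σ m : {m // m ∈ inter n lam}, SSYT (ext m.1) n) (i j : ℕ) :
    j < ext p.1.1 i ↔ 1 ≤ (glue hdec hsupp p).entry i j ∧ (glue hdec hsupp p).entry i j ≤ n := by
  unfold glue
  simp only
  constructor
  · intro h
    rw [if_pos h]
    exact p.2.pos i j h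
  · intro h
    by_contra h1
    rw [if_neg h1] at h
    split_ifs at h <;> omega

lemma entry_ge {lam : ℕ → ℕ} {n : ℕ} (hdec : ∀ i j, i ≤ j → lam j ≤ lam i) (T : SSYT lam n)
    (i j : ℕ) (h : j < lam i) : i + 1 ≤ T.entry i j := by
  induction i with
  | zero => exact (T.pos 0 j h).1
  | succ i ih =>
    have h1 := hdec i (i + 1) (by omega)
    have := ih (by omega)
    have := T.colStrict i (i + 1) j (by omega) (by omega) h
    omega

lemma glue_bij {n : ℕ} {lam : ℕ → ℕ} (hdec : ∀ i j, i ≤ j → lam j ≤ lam i)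
    (hsupp : ∀ i, n + 1 ≤ i → lam i = 0) :
    Function.Bijective (glue (n := n) hdec hsupp) := by
  constructor
  · intro p q h
    have hpq : p.1.1 = q.1.1 := by
      funext i
      have key : ∀ j, j < ext p.1.1 i ↔ j < ext q.1.1 i := by
        intro j
        rw [glue_le hdec hsupp, glue_le hdec hsupp, h]
      rw [ext_of_lt _ _ i.2, ext_of_lt _ _ i.2] at key
      have h1 := key (p.1.1 i)
      have h2 := key (q.1.1 i)
      simp only [Fin.eta] at h1 h2
      omega
    obtain ⟨⟨m, hm⟩, T⟩ := p
    obtain ⟨⟨m', hm'⟩, T'⟩ := q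
    simp only at hpq
    subst hpq
    congr 1
    apply SSYT_ext
    funext i j
    have h1 := congrFun (congrFun (congrArg SSYT.entry h) i) j
    simp only [glue] at h1
    by_cases h2 : j < ext m i
    · simpa [h2] using h1
    · rw [T.zero i j h2, T'.zero i j h2]
  · intro T
    classical
    let μ : ℕ → ℕ := fun i => ((Finset.range (lam i)).filter fun j => T.entry i j ≤ n).card
    have hμ : ∀ i j, j < μ i ↔ j < lam i ∧ T.entry i j ≤ n := by
      intro i j
      constructor
      · intro h
        by_contra hc
        have : ((Finset.range (lam i)).filter fun j => T.entry i j ≤ n) ⊆ Finset.range j := by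
          intro k hk
          simp only [Finset.mem_filter, Finset.mem_range] at hk ⊢
          by_contra hk'
          have := T.rowWeak i j k (by omega) hk.1
          exact hc ⟨by omega, by omega⟩
        have := Finset.card_le_card this
        rw [Finset.card_range] at this
        simp only [μ] at h
        omega
      · rintro ⟨h1, h2⟩
        have : Finset.range (j + 1) ⊆
            ((Finset.range (lam i)).filter fun j => T.entry i j ≤ n) := by
          intro k hk
          simp only [Finset.mem_filter, Finset.mem_range] at hk ⊢
          have := T.rowWeak i k j (by omega) h1
          omega
        have := Finset.card_le_card this
        rw [Finset.card_range] at this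
        simp only [μ]
        omega
    have hm : (fun i : Fin n => μ i) ∈ inter n lam := by
      rw [inter, Fintype.mem_piFinset]
      intro i
      rw [Finset.mem_Icc]
      constructor
      · by_contra hc
        have hc' : μ i < lam (i + 1) := by omega
        have h1 := hdec i (i + 1) (by omega)
        have h2 := T.colStrict i (i + 1) (μ i) (by omega) (by omega) hc'
        have h3 := (T.pos (i + 1) (μ i) hc').2
        have := (hμ i (μ i)).mpr ⟨by omega, by omega⟩
        omega
      · by_contra hc
        have := (hμ i (lam i)).mp (by omega)
        omega
    have hext : ∀ i, ext (fun i : Fin n => μ i) i = μ i := by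
      intro i
      rcases lt_or_ge i n with h | h
      · rw [ext_of_lt _ _ h]
      · rw [ext_of_ge _ _ h]
        by_contra hc
        have h1 := (hμ i 0).mp (by omega)
        have := entry_ge hdec T i 0 h1.1
        omega
    refine ⟨⟨⟨fun i : Fin n => μ i, hm⟩, ⟨fun i j => if j < μ i then T.entry i j else 0,
      ?_, ?_, ?_, ?_⟩⟩, ?_⟩
    · intro i j h
      simp only [hext] at h
      rw [if_pos h]
      exact ⟨(T.pos i j ((hμ i j).mp h).1).1, ((hμ i j).mp h).2⟩
    · intro i j h
      simp only [hext] at h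
      rw [if_neg h]
    · intro i j j' hj h
      simp only [hext] at h
      rw [if_pos h, if_pos (by omega)]
      exact T.rowWeak i j j' hj ((hμ i j').mp h).1
    · intro i i' j hi h h'
      simp only [hext] at h h'
      rw [if_pos h, if_pos h']
      exact T.colStrict i i' j hi ((hμ i j).mp h).1 ((hμ i' j).mp h').1
    · apply SSYT_ext
      funext i j
      simp only [glue, hext]
      split_ifs with h1 h2
      · rfl
      · have h3 := (T.pos i j h2).2
        have h4 := hμ i j
        by_contra hc
        exact h1 (h4.mpr ⟨h2, by omega⟩)
      · exact (T.zero i j h2).symm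

lemma SSYT_zero_unique (lam : ℕ → ℕ) (hsupp : ∀ i, 0 ≤ i → lam i = 0) :
    Nonempty (Unique (SSYT lam 0)) := by
  refine ⟨⟨⟨⟨fun _ _ => 0, ?_, ?_, ?_, ?_⟩⟩, ?_⟩⟩
  · intro i j h; rw [hsupp i (by omega)] at h; omega
  · intros; rfl
  · intros; rfl
  · intro i i' j _ h; rw [hsupp i (by omega)] at h; omega
  · intro T
    apply SSYT_ext
    funext i j
    exact T.zero i j (by rw [hsupp i (by omega)]; omega)

lemma SSYT_finite (n : ℕ) : ∀ (lam : ℕ → ℕ) (_ : ∀ i j, i ≤ j → lam j ≤ lam i)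
    (_ : ∀ i, n ≤ i → lam i = 0), Finite (SSYT lam n) := by
  induction n with
  | zero =>
    intro lam _ hsupp
    obtain ⟨u⟩ := SSYT_zero_unique lam hsupp
    infer_instance
  | succ n ih =>
    intro lam hdec hsupp
    have : ∀ m : {m // m ∈ inter n lam}, Finite (SSYT (ext m.1) n) := fun m =>
      ih _ (ext_dec m.2 hdec hsupp) (fun i hi => ext_of_ge _ _ hi)
    exact Finite.of_surjective _ (glue_bij hdec hsupp).2

lemma glue_wt {n : ℕ} {lam : ℕ → ℕ} (hdec : ∀ i j, i ≤ j → lam j ≤ lam i)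
    (hsupp : ∀ i, n + 1 ≤ i → lam i = 0)
    (p : Σ m : {m // m ∈ inter n lam}, SSYT (ext m.1) n) (k : ℕ) (hk : k < n) :
    (glue hdec hsupp p).wt (k + 1) = p.2.wt (k + 1) := by
  unfold SSYT.wt
  congr 1
  ext ⟨i, j⟩
  simp only [Set.mem_ofPred_eq, glue]
  have := inter_le p.1.2 i
  split_ifs with h1
  · constructor <;> rintro ⟨a, b⟩ <;> exact ⟨by omega, b⟩
  · constructor <;> rintro ⟨a, b⟩ <;> omega
  · constructor <;> rintro ⟨a, b⟩ <;> omega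

lemma glue_wt_last {n : ℕ} {lam : ℕ → ℕ} (hdec : ∀ i j, i ≤ j → lam j ≤ lam i)
    (hsupp : ∀ i, n + 1 ≤ i → lam i = 0)
    (p : Σ m : {m // m ∈ inter n lam}, SSYT (ext m.1) n) :
    (glue hdec hsupp p).wt (n + 1) = lam n + ∑ j : Fin n, (lam j - p.1.1 j) := by
  unfold SSYT.wt
  have : {q : ℕ × ℕ | q.2 < lam q.1 ∧ (glue hdec hsupp p).entry q.1 q.2 = n + 1} =
      (((Finset.range (n + 1)).sigma fun i => Finset.Ico (ext p.1.1 i) (lam i)).map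
        (Equiv.sigmaEquivProd ℕ ℕ).toEmbedding : Finset (ℕ × ℕ)) := by
    ext ⟨i, j⟩
    simp only [Set.mem_ofPred_eq, glue, Finset.coe_map, Set.mem_image, Finset.mem_coe,
      Finset.mem_sigma, Finset.mem_range, Finset.mem_Ico, Equiv.coe_toEmbedding]
    constructor
    · rintro ⟨a, b⟩
      refine ⟨⟨i, j⟩, ⟨?_, ?_, a⟩, rfl⟩
      · by_contra hc
        rw [hsupp i (by simp only at hc; omega)] at a
        omega
      · by_contra hc
        simp only [not_le] at hc
        rw [if_pos hc] at b
        have := (p.2.pos i j hc).2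
        omega
    · rintro ⟨⟨i', j'⟩, ⟨a, b, c⟩, h⟩
      simp only [Equiv.sigmaEquivProd_apply, Prod.mk.injEq] at h
      obtain ⟨rfl, rfl⟩ := h
      simp only at a b c
      refine ⟨c, ?_⟩
      rw [if_neg (by omega), if_pos c]
  rw [this, Set.ncard_coe_finset, Finset.card_map, Finset.card_sigma, Finset.sum_range_succ,
    add_comm]
  simp only [Nat.card_Ico]
  congr 1
  · rw [ext_of_ge _ _ le_rfl]; rfl
  · rw [Finset.sum_range]
    apply Finset.sum_congr rfl
    intro j _
    rw [ext_of_lt _ _ j.2]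

lemma schur_branch (n : ℕ) (lam : ℕ → ℕ) (hdec : ∀ i j, i ≤ j → lam j ≤ lam i)
    (hsupp : ∀ i, n + 1 ≤ i → lam i = 0) :
    schurN (n + 1) lam = ∑ m ∈ inter n lam,
      X (n + 1) ^ (lam n + ∑ j : Fin n, (lam j - m j)) * schurN n (ext m) := by
  classical
  have : ∀ m : {m // m ∈ inter n lam}, Finite (SSYT (ext m.1) n) := fun m =>
      SSYT_finite n _ (ext_dec m.2 hdec hsupp) (fun i hi => ext_of_ge _ _ hi)
  have : ∀ m : {m // m ∈ inter n lam}, Fintype (SSYT (ext m.1) n) := fun m =>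
    Fintype.ofFinite _
  have := SSYT_finite (n + 1) lam hdec hsupp
  have : Fintype (SSYT lam (n + 1)) := Fintype.ofFinite _
  rw [← Finset.sum_coe_sort (inter n lam)]
  unfold schurN
  simp only [finsum_eq_sum_of_fintype]
  rw [← (Equiv.ofBijective _ (glue_bij hdec hsupp)).sum_comp, Fintype.sum_sigma]
  apply Finset.sum_congr rfl
  intro m _
  rw [Finset.mul_sum]
  apply Finset.sum_congr rfl
  intro T _
  rw [Equiv.ofBijective_apply, Finset.prod_range_succ, glue_wt_last, mul_comm]
  congr 1
  apply Finset.prod_congr rfl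
  intro k hk
  rw [glue_wt _ _ _ _ (Finset.mem_range.mp hk)]

lemma bialternant (n : ℕ) : ∀ (lam : ℕ → ℕ) (_ : ∀ i j, i ≤ j → lam j ≤ lam i)
    (_ : ∀ i, n ≤ i → lam i = 0), D n lam = D n (fun _ => 0) * schurN n lam := by
  induction n with
  | zero =>
    intro lam _ hsupp
    obtain ⟨u⟩ := SSYT_zero_unique lam hsupp
    simp [D, schurN, finsum_unique]
  | succ n ih =>
    intro lam hdec hsupp
    rw [D_branch n lam hdec, D_zero_succ, schur_branch n lam hdec hsupp, mul_assoc]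
    congr 1
    rw [Finset.mul_sum]
    apply Finset.sum_congr rfl
    intro m hm
    rw [ih _ (ext_dec hm hdec hsupp) (fun i hi => ext_of_ge _ _ hi)]
    ring


/-- the embedding of positions into variable indices -/
def iota (n : ℕ) : Fin n ↪ ℕ := ⟨fun i => (i : ℕ) + 1, fun a b h => by
  simpa [Fin.ext_iff] using h⟩

/-- the action of a permutation of the first `n` variables -/
noncomputable def act {n : ℕ} (σ : Equiv.Perm (Fin n)) : MvPolynomial ℕ ℤ →ₐ[ℤ] MvPolynomial ℕ ℤ :=
  rename (Equiv.Perm.viaEmbeddingHom (iota n) σ)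

lemma act_mul {n : ℕ} (σ τ : Equiv.Perm (Fin n)) (f : MvPolynomial ℕ ℤ) :
    act (σ * τ) f = act σ (act τ f) := by
  unfold act
  rw [map_mul, rename_rename]
  rfl

lemma act_X {n : ℕ} (σ : Equiv.Perm (Fin n)) (i : Fin n) :
    act σ (X ((i : ℕ) + 1)) = X ((σ i : ℕ) + 1) := by
  unfold act
  rw [rename_X]
  congr 1
  exact Equiv.Perm.viaEmbedding_apply σ (iota n) i

lemma act_swap {n : ℕ} (i j : Fin n) :
    act (Equiv.swap i j) = rename (Equiv.swap ((i : ℕ) + 1) ((j : ℕ) + 1)) := by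
  unfold act
  congr 1
  funext x
  by_cases hx : x ∈ Set.range (iota n)
  · obtain ⟨k, rfl⟩ := hx
    refine (Equiv.Perm.viaEmbedding_apply _ (iota n) k).trans ?_
    exact (swap_succ i j k).symm
  · refine (Equiv.Perm.viaEmbedding_apply_of_notMem _ (iota n) x hx).trans ?_
    rw [Equiv.swap_apply_of_ne_of_ne]
    · rintro rfl; exact hx ⟨i, rfl⟩
    · rintro rfl; exact hx ⟨j, rfl⟩

/-- the antisymmetrizer -/
noncomputable def A (n : ℕ) (f : MvPolynomial ℕ ℤ) : MvPolynomial ℕ ℤ :=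
  ∑ σ : Equiv.Perm (Fin n), (Equiv.Perm.sign σ : ℤ) • act σ f

lemma A_sub (n : ℕ) (f g : MvPolynomial ℕ ℤ) : A n (f - g) = A n f - A n g := by
  simp [A, smul_sub, Finset.sum_sub_distrib]

lemma A_swap {n : ℕ} (i j : Fin n) (h : i ≠ j) (f : MvPolynomial ℕ ℤ) :
    A n (rename (Equiv.swap ((i : ℕ) + 1) ((j : ℕ) + 1)) f) = - A n f := by
  rw [← act_swap]
  unfold A
  rw [← Finset.sum_neg_distrib]
  apply Fintype.sum_equiv (Equiv.mulRight (Equiv.swap i j))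
  intro σ
  rw [Equiv.coe_mulRight, act_mul, Equiv.Perm.sign_mul, Equiv.Perm.sign_swap h]
  simp

lemma A_D (n : ℕ) (lam : ℕ → ℕ) :
    A n (∏ i : Fin n, X ((i : ℕ) + 1) ^ (lam i + (n - 1 - (i : ℕ)))) = D n lam := by
  unfold A D
  rw [Matrix.det_apply']
  apply Finset.sum_congr rfl
  intro σ _
  rw [map_prod, zsmul_eq_mul]
  congr 1
  apply Finset.prod_congr rfl
  intro i _
  rw [map_pow, act_X]
  rfl

lemma sym_of_div (a b : ℕ) (hab : a ≠ b) (f g : MvPolynomial ℕ ℤ)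
    (h : (X a - X b) * f = g - rename (Equiv.swap a b) g) :
    rename (Equiv.swap a b) f = f := by
  have h2 := congrArg (rename (Equiv.swap a b)) h
  have h3 : rename (Equiv.swap a b) (rename (Equiv.swap a b) g) = g := by
    rw [rename_rename]
    have : (Equiv.swap a b : ℕ → ℕ) ∘ Equiv.swap a b = id := by funext x; simp
    rw [this, rename_id_apply]
  rw [map_mul, map_sub, map_sub, h3, rename_X, rename_X, Equiv.swap_apply_left,
    Equiv.swap_apply_right] at h2
  apply mul_left_cancel₀ (X_sub_ne a b hab)
  linear_combination - h2 - h

lemma A_step {n : ℕ} (i i' : Fin n) (hne : i ≠ i') (f g m : MvPolynomial ℕ ℤ)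
    (h : (X ((i : ℕ) + 1) - X ((i' : ℕ) + 1)) * f
      = g - rename (Equiv.swap ((i : ℕ) + 1) ((i' : ℕ) + 1)) g)
    (hm : rename (Equiv.swap ((i : ℕ) + 1) ((i' : ℕ) + 1)) m = m) :
    A n (X ((i : ℕ) + 1) * m * f) = A n (m * g) := by
  have hne' : (i : ℕ) + 1 ≠ (i' : ℕ) + 1 := by
    intro h'; apply hne; ext; omega
  have hf := sym_of_div _ _ hne' f g h
  have h1 := A_swap i i' hne (X ((i : ℕ) + 1) * m * f)
  rw [map_mul, map_mul, hm, hf, rename_X, Equiv.swap_apply_left] at h1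
  have h2 := A_swap i i' hne (m * g)
  rw [map_mul, hm] at h2
  have h3 : A n (X ((i : ℕ) + 1) * m * f - X ((i' : ℕ) + 1) * m * f)
      = A n (m * g - m * rename (Equiv.swap ((i : ℕ) + 1) ((i' : ℕ) + 1)) g) := by
    congr 1
    linear_combination m * h
  rw [A_sub, A_sub, h1, h2] at h3
  have : (2 : MvPolynomial ℕ ℤ) ≠ 0 := two_ne_zero
  apply mul_left_cancel₀ this
  linear_combination h3

lemma A_mul_sym {n : ℕ} (f g : MvPolynomial ℕ ℤ)
    (hg : ∀ (i : ℕ), i + 1 < n → rename (Equiv.swap (i + 1) (i + 2)) g = g) :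
    A n (f * g) = A n f * g := by
  have key : ∀ σ : Equiv.Perm (Fin n), act σ g = g := by
    rcases n with _ | n
    · intro σ
      have : σ = 1 := Subsingleton.elim _ _
      subst this
      unfold act
      rw [map_one]
      exact rename_id_apply g
    intro σ
    have hσ : σ ∈ Submonoid.closure
        (Set.range fun i : Fin n => Equiv.swap i.castSucc i.succ) := by
      rw [Equiv.Perm.mclosure_swap_castSucc_succ]; trivial
    induction hσ using Submonoid.closure_induction with
    | mem x hx =>
      obtain ⟨i, rfl⟩ := hx
      simp only
      rw [act_swap]
      exact hg i (by omega)
    | one =>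
      unfold act
      rw [map_one]
      exact rename_id_apply g
    | mul x y _ _ hx hy => rw [act_mul, hy, hx]
  unfold A
  rw [Finset.sum_mul]
  apply Finset.sum_congr rfl
  intro σ _
  rw [map_mul, key, smul_mul_assoc]

lemma papply {N : ℕ} (u : Equiv.Perm (Fin N)) (v : Fin N) : u (u⁻¹ v) = v :=
  u.apply_symm_apply v

lemma pinv {N : ℕ} (u : Equiv.Perm (Fin N)) (v : Fin N) : u⁻¹ (u v) = v :=
  u.symm_apply_apply v

lemma main (n N : ℕ) (hnN : n ≤ N) (lam : ℕ → ℕ)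
    (S : Equiv.Perm (Fin N) → MvPolynomial ℕ ℤ) (hS : SchubertFamily N S)
    (π : Equiv.Perm (Fin N))
    (hπ1 : ∀ i : Fin N, (i : ℕ) < n → (π i : ℕ) = lam (n - 1 - (i : ℕ)) + (i : ℕ))
    (hinc : ∀ a b : Fin N, a < b → (b : ℕ) < n → π a < π b)
    (hinc' : ∀ a b : Fin N, a < b → n ≤ (a : ℕ) → π a < π b) :
    D n (fun _ => 0) * S π = D n lam := by
  have split : ∀ e : Fin N → ℕ, (∀ k : Fin N, n ≤ (k : ℕ) → e k = 0) →
      mon e = ∏ i : Fin n, X ((i : ℕ) + 1) ^ e (Fin.castLE hnN i) := by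
    intro e he
    unfold mon
    symm
    apply Finset.prod_of_injOn (Fin.castLE hnN)
    · exact (Fin.castLE_injective hnN).injOn
    · intro _ _; simp
    · intro k _ hk
      rw [he k, pow_zero]
      by_contra hc
      exact hk ⟨⟨k, by omega⟩, by simp, rfl⟩
    · intro i _; rfl
  have claim : ∀ w, Av n w → (∀ j : Fin N, n ≤ (j : ℕ) → w j = π j) →
      A n (mon (E n w) * S w) = D n lam := by
    apply dom_induct
    · intro w hw hwπ
      have hE : ∀ k, E n w k = 0 := by
        intro k
        unfold E
        rw [Finset.card_eq_zero, Finset.filter_eq_empty_iff]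
        rintro j - ⟨h1, h2, h3⟩
        exact absurd (hw k j h1 h2) (not_lt.mpr h3.le)
      have hmon : mon (E n w) = 1 := by simp [mon, hE]
      have hAv : Av N w := by
        intro a b c hab hbc _ h1 h2
        rcases lt_or_ge (b : ℕ) n with hb | hb
        · exact absurd (hw a b hab hb) (not_lt.mpr (h1.trans h2).le)
        · rw [hwπ b hb, hwπ c (by simp only [Fin.lt_def] at hbc; omega)] at h2
          exact absurd (hinc' b c hbc hb) (not_lt.mpr h2.le)
      have hdom := dominant hS w hAv
      -- values of w on the first n positions
      have hval : ∀ i : Fin n, (w (Fin.castLE hnN i) : ℕ) = lam i + (n - 1 - (i : ℕ)) := by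
        have s1 : StrictMono (fun i : Fin n => w (Fin.castLE hnN (Fin.rev i))) := by
          intro a b hab
          apply hw
          · simp only [Fin.lt_def, Fin.val_castLE, Fin.val_rev] at *; omega
          · exact (Fin.rev a).2
        have s2 : StrictMono (fun i : Fin n => π (Fin.castLE hnN i)) := by
          intro a b hab
          apply hinc
          · exact hab
          · exact b.2
        have r1 : ∀ (u : Equiv.Perm (Fin N)) (v : Fin N),
            v ∈ Set.range (fun i : Fin n => u (Fin.castLE hnN i)) ↔ (u⁻¹ v : ℕ) < n := by
          intro u v
          constructor
          · rintro ⟨i, rfl⟩; simp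
          · intro h
            exact ⟨⟨u⁻¹ v, h⟩, by simp [Fin.castLE]⟩
        have r2 : Set.range (fun i : Fin n => w (Fin.castLE hnN (Fin.rev i)))
            = Set.range (fun i : Fin n => w (Fin.castLE hnN i)) :=
          Fin.rev_surjective.range_comp (fun i : Fin n => w (Fin.castLE hnN i))
        have r3 : Set.range (fun i : Fin n => w (Fin.castLE hnN (Fin.rev i)))
            = Set.range (fun i : Fin n => π (Fin.castLE hnN i)) := by
          rw [r2]
          ext v
          rw [r1, r1]
          constructor
          · intro h
            by_contra hc
            have h1 := hwπ (π⁻¹ v) (by omega)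
            rw [papply] at h1
            rw [← h1, pinv] at h
            omega
          · intro h
            by_contra hc
            have h1 := hwπ (w⁻¹ v) (by omega)
            rw [papply] at h1
            rw [h1, pinv] at h
            omega
        have s3 := (s1.range_inj s2).mp r3
        intro i
        have h1 := congrFun s3 (Fin.rev i)
        simp only [Fin.rev_rev] at h1
        rw [h1, hπ1 _ (Fin.rev i).2]
        simp only [Fin.val_castLE, Fin.val_rev]
        rw [show n - 1 - (n - ((i : ℕ) + 1)) = i by omega]
        omega
      let c : Fin N → ℕ := fun k => if (k : ℕ) < n then w k else 0
      have hEc : ∀ k, E N w k + c k = N - 1 - (k : ℕ) := by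
        intro k
        rcases lt_or_ge (k : ℕ) n with hk | hk
        · simp only [c, hk, if_true]
          have h1 : (Finset.univ.filter fun j : Fin N => w k < w j).card = N - 1 - w k := by
            rw [← Fin.card_Ioi (w k)]
            apply Finset.card_equiv w
            intro j
            simp
          have h2 : (Finset.univ.filter fun j : Fin N => w k < w j)
              = (Finset.univ.filter fun j : Fin N => k < j ∧ (j : ℕ) < N ∧ w k < w j)
                ∪ Finset.Iio k := by
            ext j
            simp only [Finset.mem_filter, Finset.mem_univ, true_and, Finset.mem_union,
              Finset.mem_Iio, j.2]
            constructor
            · intro h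
              rcases lt_trichotomy j k with h' | h' | h'
              · exact Or.inr h'
              · subst h'; simp at h
              · exact Or.inl ⟨h', h⟩
            · rintro (h | h)
              · exact h.2
              · exact hw j k h hk
          rw [h2, Finset.card_union_of_disjoint, Fin.card_Iio] at h1
          · have := (w k).2
            unfold E
            omega
          · rw [Finset.disjoint_left]
            intro j hj hj'
            simp only [Finset.mem_filter, Finset.mem_Iio] at hj hj'
            exact absurd hj.2.1 (not_lt.mpr hj'.le)
        · simp only [c, not_lt.mpr hk, if_false, add_zero]
          unfold E
          have h2 : (Finset.univ.filter fun j : Fin N => k < j ∧ (j : ℕ) < N ∧ w k < w j)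
              = Finset.Ioi k := by
            ext j
            simp only [Finset.mem_filter, Finset.mem_univ, true_and, Finset.mem_Ioi, j.2,
              and_iff_left_iff_imp]
            intro h
            rw [hwπ k hk, hwπ j (by simp only [Fin.lt_def] at h; omega)]
            exact hinc' k j h hk
          rw [h2, Fin.card_Ioi]
      have hSw : S w = mon c := by
        apply mul_left_cancel₀ (mon_ne (E N w))
        rw [hdom]
        unfold mon
        rw [← Finset.prod_mul_distrib]
        apply Finset.prod_congr rfl
        intro k _
        rw [← pow_add, hEc]
      rw [hmon, one_mul, hSw, split c (fun k hk => by simp [c, not_lt.mpr hk]), ← A_D]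
      congr 1
      apply Finset.prod_congr rfl
      intro i _
      rw [← hval]
      simp [c]
    · intro w i h hn hlt hE1 hE2 IH hwπ
      rw [mon_add_one _ _ i hE1]
      have IH' := IH (by
        intro j hj
        rw [Equiv.Perm.mul_apply, Equiv.swap_apply_of_ne_of_ne]
        · exact hwπ j hj
        · rintro rfl; omega
        · rintro rfl; simp only at hj; omega)
      rw [← IH']
      exact A_step (n := n) ⟨i, by omega⟩ ⟨i + 1, hn⟩ (by simp) _ _ _ (hS.2 w i h hlt)
        (rename_mon _ i ⟨i + 1, h⟩ hE2)
  have hAvπ : Av n π := by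
    intro a b c hab hbc hc h1 h2
    exact absurd (hinc b c hbc hc) (not_lt.mpr h2.le)
  have hfin := claim π hAvπ (fun _ _ => rfl)
  rw [A_mul_sym] at hfin
  · rw [← hfin]
    congr 1
    rw [split, ← A_D]
    · congr 1
      apply Finset.prod_congr rfl
      intro i _
      congr 1
      unfold E
      have : (Finset.univ.filter fun j : Fin N => Fin.castLE hnN i < j ∧ (j : ℕ) < n ∧
          π (Fin.castLE hnN i) < π j) = (Finset.Ioi i).map (Fin.castLEEmb hnN) := by
        ext j
        simp only [Finset.mem_filter, Finset.mem_univ, true_and, Finset.mem_map, Finset.mem_Ioi,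
          Fin.castLEEmb_apply]
        constructor
        · rintro ⟨h1, h2, h3⟩
          exact ⟨⟨j, h2⟩, h1, rfl⟩
        · rintro ⟨a, h1, rfl⟩
          exact ⟨h1, a.2, hinc _ _ h1 a.2⟩
      rw [this, Finset.card_map, Fin.card_Ioi]
      omega
    · intro k hk
      unfold E
      rw [Finset.card_eq_zero, Finset.filter_eq_empty_iff]
      rintro j - ⟨h1, h2, h3⟩
      simp only [Fin.lt_def] at h1
      omega
  · intro i hi
    have hlt := hinc ⟨i, by omega⟩ ⟨i + 1, by omega⟩ (by simp [Fin.lt_def]) hi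
    exact sym_of_div _ _ (by omega) _ _ (hS.2 π ⟨i, by omega⟩ (by simp only; omega) hlt)

end SchurSchubert

/-- For every partition `λ` with at most `n` parts, the Schur polynomial
`s_λ(x_1,…,x_n)` is the Schubert polynomial `𝔖_{π_λ}`, where `π_λ` is the permutation
with `π_λ(i) = λ_{n-i+1} + i` for `i ≤ n` (0-indexed: `π(i) = λ(n-1-i) + i`), and for
`i > n`, `π_λ(i)` is the smallest positive integer not among `π_λ(1), …, π_λ(i-1)`. -/
theorem schur_is_schubert (n N : ℕ) (hnN : n ≤ N) (lam : ℕ → ℕ)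
    (hdec : ∀ i j, i ≤ j → lam j ≤ lam i) (hsupp : ∀ i, n ≤ i → lam i = 0)
    (S : Equiv.Perm (Fin N) → MvPolynomial ℕ ℤ) (hS : SchubertFamily N S)
    (π : Equiv.Perm (Fin N))
    (hπ1 : ∀ i : Fin N, (i : ℕ) < n → (π i : ℕ) = lam (n - 1 - (i : ℕ)) + (i : ℕ))
    (hπ2 : ∀ i : Fin N, n ≤ (i : ℕ) →
      (π i : ℕ) = sInf {m : ℕ | ∀ j : Fin N, (j : ℕ) < (i : ℕ) → (π j : ℕ) ≠ m}) :
    S π = schurN n lam := by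
  have hinc : ∀ a b : Fin N, a < b → (b : ℕ) < n → π a < π b := by
    intro a b hab hb
    rw [Fin.lt_def] at hab ⊢
    rw [hπ1 a (by omega), hπ1 b hb]
    have := hdec (n - 1 - (b : ℕ)) (n - 1 - (a : ℕ)) (by omega)
    omega
  have hinc' : ∀ a b : Fin N, a < b → n ≤ (a : ℕ) → π a < π b := by
    intro a b hab ha
    have h1 : (π a : ℕ) ≤ π b := by
      rw [hπ2 a ha]
      apply Nat.sInf_le
      intro j hj h
      have : j = b := π.injective (Fin.ext h)
      subst this
      rw [Fin.lt_def] at hab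
      omega
    have h2 : π a ≠ π b := fun h => hab.ne (π.injective h)
    exact lt_of_le_of_ne h1 h2
  apply mul_left_cancel₀ (SchurSchubert.D_zero_ne n)
  rw [SchurSchubert.main n N hnN lam S hS π hπ1 hinc hinc',
    SchurSchubert.bialternant n lam hdec hsupp]
end

section
/- For weak compositions a and b, the product of fundamental slide polynomials satisfies 𝔉_a · 𝔉_b = ∑_c C_{a,b}^c 𝔉_c, where C_{a,b}^c is the multiplicity of c in the slide product a ⧢ b. In particular the fundamental slide basis has nonnegative integer structure coefficients. -/
open MvPolynomial

/-- The monomial `x^b` in `n` variables, for a weak composition recorded as a list. -/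
noncomputable def xlist (n : ℕ) (b : List ℕ) : MvPolynomial (Fin n) ℤ :=
  ∏ i : Fin n, X i ^ b.getD (i : ℕ) 0

/-- Dominance order: every partial sum of `b` is at least that of `a`. -/
def DomL (b a : List ℕ) : Prop := ∀ k, (a.take k).sum ≤ (b.take k).sum

/-- The positive part of a weak composition: delete all zero entries. -/
def posL (b : List ℕ) : List ℕ := b.filter (fun x => x ≠ 0)

/-- `β` refines `α`: `α` is obtained by summing consecutive (nonempty) blocks of `β`. -/
def Refines (β α : List ℕ) : Prop :=
  ∃ L : List (List ℕ), L.flatten = β ∧ L.map List.sum = α ∧ ∀ l ∈ L, l ≠ []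

/-- The fundamental slide polynomial `𝔉_a` of a weak composition `a` of length `n`. -/
noncomputable def FSlide (n : ℕ) (a : List ℕ) : MvPolynomial (Fin n) ℤ :=
  ∑ᶠ (b : List ℕ) (_ : b.length = n ∧ DomL b a ∧ Refines (posL b) (posL a)), xlist n b

/-- The odd-letter word `A` of a weak composition `a`: `a_1` copies of `2ℓ(a)-1`, then
`a_2` copies of `2ℓ(a)-3`, …, then `a_{ℓ(a)}` copies of `1`. -/
def wordA (a : List ℕ) : List ℕ :=
  ((List.range a.length).map
    (fun i => List.replicate (a.getD i 0) (2 * a.length - 1 - 2 * i))).flatten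

/-- The even-letter word `B` of a weak composition `b`: `b_1` copies of `2ℓ(b)`, then
`b_2` copies of `2ℓ(b)-2`, …, then `b_{ℓ(b)}` copies of `2`. -/
def wordB (b : List ℕ) : List ℕ :=
  ((List.range b.length).map
    (fun i => List.replicate (b.getD i 0) (2 * b.length - 2 * i))).flatten

/-- The sequence of maximal weakly increasing runs of a word. -/
def runs : List ℕ → List (List ℕ)
  | [] => []
  | [x] => [[x]]
  | x :: y :: rest =>
      if x ≤ y then
        match runs (y :: rest) with
        | [] => [[x]]
        | r :: rs => (x :: r) :: rs
      else [x] :: runs (y :: rest)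

/-- The weak composition counting odd letters in each word of a sequence of words. -/
def compOdd (S : List (List ℕ)) : List ℕ :=
  S.map (fun w => (w.filter (fun x => x % 2 == 1)).length)

/-- The weak composition counting even letters in each word of a sequence of words. -/
def compEven (S : List (List ℕ)) : List ℕ :=
  S.map (fun w => (w.filter (fun x => x % 2 == 0)).length)

/-- The weak composition counting all letters in each word of a sequence of words. -/
def compAll (S : List (List ℕ)) : List ℕ := S.map List.length

/-- `C ∈ Sh(a,b)`: `C` is a shuffle of the words `A(a)` and `B(b)` (its odd subword is
`A(a)`, its even subword is `B(b)`) with `Comp_odd(Runs(C)) ≥ a` and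
`Comp_even(Runs(C)) ≥ b` in dominance order. -/
def InSh (a b C : List ℕ) : Prop :=
  C.filter (fun x => x % 2 == 1) = wordA a ∧
  C.filter (fun x => x % 2 == 0) = wordB b ∧
  DomL (compOdd (runs C)) a ∧ DomL (compEven (runs C)) b

/-- `S = BumpRuns(C)`: `S` is obtained from `Runs(C)` by inserting empty words, satisfies
`Comp_odd(S) ≥ a` and `Comp_even(S) ≥ b`, and is dominance-minimal among all such
insertions. -/
def IsBumpRuns (a b C : List ℕ) (S : List (List ℕ)) : Prop :=
  S.filter (fun l => l ≠ []) = runs C ∧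
  DomL (compOdd S) a ∧ DomL (compEven S) b ∧
  ∀ S' : List (List ℕ), S'.filter (fun l => l ≠ []) = runs C →
    DomL (compOdd S') a → DomL (compEven S') b → DomL (compAll S') (compAll S)

/-- The multiplicity of `c` in the slide product `a ⧢ b`: the number of shuffles
`C ∈ Sh(a,b)` with `Comp(BumpRuns(C)) = c`. -/
noncomputable def slideMult (a b c : List ℕ) : ℕ :=
  Nat.card {p : List ℕ × List (List ℕ) //
    InSh a b p.1 ∧ IsBumpRuns a b p.1 p.2 ∧ compAll p.2 = c}

/-! ### Auxiliary notions -/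

/-- The subsequence of nonempty words. -/
def neW (S : List (List ℕ)) : List (List ℕ) := S.filter (fun l => l ≠ [])

/-- Flag condition: every letter `x` in the word at (0-based) position `p` satisfies
`p + (x-1)/2 < n`. -/
def VV : ℕ → List (List ℕ) → Prop
  | _, [] => True
  | n, w :: S => (∀ x ∈ w, x ≤ 2 * n ∧ 0 < n) ∧ VV (n - 1) S

/-- The common recursive form of `wordA` (`e = 1`) and `wordB` (`e = 2`). -/
def GG (e : ℕ) : List ℕ → List ℕ
  | [] => []
  | a0 :: a => List.replicate a0 (2 * a.length + e) ++ GG e a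

lemma wordA_eq (a : List ℕ) : wordA a = GG 1 a := by
  induction a with
  | nil => rfl
  | cons a0 a ih =>
    rw [GG, ← ih, wordA, wordA]
    simp only [List.length_cons, List.range_succ_eq_map, List.map_cons, List.flatten_cons,
      List.map_map]
    congr 2
    apply List.map_congr_left
    intro i hi
    simp only [Function.comp, List.getD_cons_succ]
    congr 1
    omega

lemma wordB_eq (a : List ℕ) : wordB a = GG 2 a := by
  induction a with
  | nil => rfl
  | cons a0 a ih =>
    rw [GG, ← ih, wordB, wordB]
    simp only [List.length_cons, List.range_succ_eq_map, List.map_cons, List.flatten_cons,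
      List.map_map]
    congr 2
    apply List.map_congr_left
    intro i hi
    simp only [Function.comp, List.getD_cons_succ]
    congr 1
    omega

lemma GG_length (e : ℕ) (a : List ℕ) : (GG e a).length = a.sum := by
  induction a with
  | nil => rfl
  | cons a0 a ih => simp [GG, ih]

lemma GG_le (e : ℕ) (he : e ≤ 2) (a : List ℕ) :
    ∀ x ∈ GG e a, x ≤ 2 * a.length ∧ 0 < a.length := by
  induction a with
  | nil => simp [GG]
  | cons a0 a ih =>
    intro x hx
    simp only [GG, List.mem_append, List.mem_replicate, List.length_cons] at hx ⊢
    rcases hx with h | h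
    · omega
    · have := ih x h
      omega

lemma VV_mono (S : List (List ℕ)) : ∀ n m, n ≤ m → VV n S → VV m S := by
  induction S with
  | nil => intros; trivial
  | cons w S ih =>
    intro n m h hv
    refine ⟨fun x hx => ?_, ih (n-1) (m-1) (by omega) hv.2⟩
    have := hv.1 x hx
    omega

lemma VV_mem (S : List (List ℕ)) : ∀ n, VV n S → ∀ x ∈ S.flatten, x ≤ 2 * n ∧ 0 < n := by
  induction S with
  | nil => simp
  | cons w S ih =>
    intro n hv x hx
    rw [List.flatten_cons, List.mem_append] at hx
    rcases hx with h | h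
    · exact hv.1 x h
    · have := ih _ hv.2 x h
      omega

lemma VV_of_flatten_nil (S : List (List ℕ)) : ∀ n, S.flatten = [] → VV n S := by
  induction S with
  | nil => intros; trivial
  | cons w S ih =>
    intro n h
    rw [List.flatten_cons, List.append_eq_nil_iff] at h
    exact ⟨by simp [h.1], ih _ h.2⟩

lemma VV_neW (S : List (List ℕ)) : ∀ n, VV n S → VV n (neW S) := by
  induction S with
  | nil => intros; trivial
  | cons w S ih =>
    intro n h
    by_cases hw : w = []
    · have : neW (w :: S) = neW S := by simp [neW, hw]
      rw [this]
      exact ih _ (VV_mono _ _ _ (by omega) h.2)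
    · have : neW (w :: S) = w :: neW S := by simp [neW, hw]
      rw [this]
      exact ⟨h.1, ih _ h.2⟩

lemma flatten_neW (S : List (List ℕ)) : (neW S).flatten = S.flatten := by
  induction S with
  | nil => rfl
  | cons w S ih =>
    by_cases hw : w = []
    · have : neW (w :: S) = neW S := by simp [neW, hw]
      rw [this, ih, hw]; simp
    · have : neW (w :: S) = w :: neW S := by simp [neW, hw]
      simp [this, ih]

lemma posL_compAll (S : List (List ℕ)) : posL (compAll S) = compAll (neW S) := by
  induction S with
  | nil => rfl
  | cons w S ih =>
    by_cases hw : w = []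
    · have : neW (w :: S) = neW S := by simp [neW, hw]
      rw [this, ← ih]
      simp [compAll, posL, hw]
    · have : neW (w :: S) = w :: neW S := by simp [neW, hw]
      rw [this]
      have h2 : compAll (w :: neW S) = w.length :: compAll (neW S) := rfl
      rw [h2, ← ih]
      simp [compAll, posL, hw]

lemma VV_filter (S : List (List ℕ)) : ∀ n, VV n S ↔
    VV n (S.map (List.filter (fun x => x % 2 == 1))) ∧
    VV n (S.map (List.filter (fun x => x % 2 == 0))) := by
  induction S with
  | nil => intro n; simp [VV]
  | cons w S ih =>
    intro n
    simp only [List.map_cons, VV]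
    rw [ih]
    simp only [List.mem_filter, beq_iff_eq]
    constructor
    · rintro ⟨h1, h2, h3⟩
      exact ⟨⟨fun x hx => h1 x hx.1, h2⟩, ⟨fun x hx => h1 x hx.1, h3⟩⟩
    · rintro ⟨⟨h1, h2⟩, ⟨h3, h4⟩⟩
      refine ⟨fun x hx => ?_, h2, h4⟩
      rcases Nat.mod_two_eq_zero_or_one x with h | h
      · exact h3 x ⟨hx, h⟩
      · exact h1 x ⟨hx, h⟩

/-- Dominance is the flag condition, for cuts of the words `A`, `B`. -/
lemma dom_iff_aux (e : ℕ) (he : e ≤ 2) (he' : 1 ≤ e) (O : List (List ℕ)) :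
    ∀ (a : List ℕ) (m : ℕ), O.flatten = (GG e a).drop m →
    ((∀ k, (a.take k).sum ≤ m + ((compAll O).take k).sum) ↔ VV a.length O) := by
  induction O with
  | nil =>
    intro a m h
    have h1 : (GG e a).length ≤ m := by
      rw [List.flatten_nil, eq_comm, List.drop_eq_nil_iff] at h
      exact h
    rw [GG_length] at h1
    refine ⟨fun _ => trivial, fun _ k => ?_⟩
    have : (a.take k).sum ≤ a.sum := (List.take_sublist k a).sum_le_sum (by simp)
    omega
  | cons w O ih =>
    intro a m h
    cases a with
    | nil =>
      refine ⟨fun _ => VV_of_flatten_nil _ _ (by simpa [GG] using h), fun _ k => by simp⟩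
    | cons a0 a =>
      have hw : ∀ x ∈ w, x ≤ 2 * (a0 :: a).length ∧ 0 < (a0 :: a).length := by
        intro x hx
        apply GG_le e he
        apply List.mem_of_mem_drop (i := m)
        rw [← h]
        simp [hx]
      have hO : O.flatten = (GG e (a0 :: a)).drop (m + w.length) := by
        rw [← List.drop_drop, ← h]
        simp
      have hsum : ∀ k, ((compAll (w :: O)).take (k+1)).sum
          = w.length + ((compAll O).take k).sum := by
        intro k; simp [compAll]
      by_cases hc : a0 ≤ m + w.length
      · have hO' : O.flatten = (GG e a).drop (m + w.length - a0) := by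
          rw [hO, GG, List.drop_append]
          simp [hc]
        have := ih a _ hO'
        constructor
        · intro hk
          refine ⟨hw, this.1 fun k => ?_⟩
          have h3 := hk (k+1)
          rw [hsum, List.take_succ_cons, List.sum_cons] at h3
          omega
        · intro hv k
          cases k with
          | zero => simp
          | succ k =>
            have h3 := this.2 hv.2 k
            rw [hsum, List.take_succ_cons, List.sum_cons]
            omega
      · constructor
        · intro hk
          have h3 := hk 1
          rw [hsum] at h3
          simp at h3
          omega
        · intro hv
          exfalso
          have := VV_mem _ _ hv.2 (2 * a.length + e) (by
            rw [hO, GG, List.drop_append]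
            simp
            left; omega)
          simp at this
          omega

lemma dom_iff (e : ℕ) (he : e ≤ 2) (he' : 1 ≤ e) (O : List (List ℕ)) (a : List ℕ)
    (h : O.flatten = GG e a) : DomL (compAll O) a ↔ VV a.length O := by
  rw [← dom_iff_aux e he he' O a 0 (by simpa using h)]
  simp [DomL]

lemma compOdd_eq (S : List (List ℕ)) :
    compOdd S = compAll (S.map (List.filter (fun x => x % 2 == 1))) := by
  simp [compOdd, compAll]

lemma compEven_eq (S : List (List ℕ)) :
    compEven S = compAll (S.map (List.filter (fun x => x % 2 == 0))) := by
  simp [compEven, compAll]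

lemma dom_both (n : ℕ) (a b : List ℕ) (ha : a.length = n) (hb : b.length = n)
    (S : List (List ℕ))
    (h1 : S.flatten.filter (fun x => x % 2 == 1) = wordA a)
    (h2 : S.flatten.filter (fun x => x % 2 == 0) = wordB b) :
    (DomL (compOdd S) a ∧ DomL (compEven S) b) ↔ VV n S := by
  rw [compOdd_eq, compEven_eq, dom_iff 1 (by norm_num) (by norm_num), 
    dom_iff 2 (by norm_num) (by norm_num), ha, hb, ← VV_filter]
  · rw [← wordB_eq, ← h2, List.filter_flatten]
  · rw [← wordA_eq, ← h1, List.filter_flatten]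

/-! ### Runs -/

lemma runs_step (w : List ℕ) (rest : List ℕ) (hw : w ≠ []) (hs : w.Pairwise (· ≤ ·)) :
    runs (w ++ rest) = w :: runs rest ∨
    ∃ r rs, runs rest = r :: rs ∧ runs (w ++ rest) = (w ++ r) :: rs := by
  induction w with
  | nil => exact absurd rfl hw
  | cons x w ih =>
    cases w with
    | nil =>
      cases rest with
      | nil => left; rfl
      | cons y rest =>
        simp only [List.singleton_append]
        rw [runs]
        split_ifs with h
        · rcases hr : runs (y :: rest) with _ | ⟨r, rs⟩
          · left; rfl
          · right; exact ⟨r, rs, rfl, rfl⟩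
        · left; rfl
    | cons y w =>
      have hxy : x ≤ y := by
        have := List.pairwise_cons.1 hs
        exact this.1 y (by simp)
      have := ih (by simp) (List.pairwise_cons.1 hs).2
      simp only [List.cons_append] at this ⊢
      rw [runs, if_pos hxy]
      rcases this with h | ⟨r, rs, h, h'⟩
      · left; rw [h]
      · right; exact ⟨r, rs, h, by rw [h']⟩

lemma runs_ne_nil (x : ℕ) (C : List ℕ) : runs (x :: C) ≠ [] := by
  cases C with
  | nil => simp [runs]
  | cons y C =>
    rw [runs]
    split_ifs
    · split <;> simp
    · simp

lemma runs_flatten (C : List ℕ) : (runs C).flatten = C := by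
  induction C with
  | nil => rfl
  | cons x C ih =>
    rcases runs_step [x] C (by simp) (by simp) with h | ⟨r, rs, h, h'⟩
    · simp only [List.singleton_append] at h
      rw [h]; simp [ih]
    · simp only [List.singleton_append] at h'
      rw [h']
      rw [h] at ih
      simpa using ih

lemma runs_nonempty (C : List ℕ) : ∀ w ∈ runs C, w ≠ [] := by
  induction C with
  | nil => simp [runs]
  | cons x C ih =>
    rcases runs_step [x] C (by simp) (by simp) with h | ⟨r, rs, h, h'⟩
    · simp only [List.singleton_append] at h
      rw [h]; simpa using ih
    · simp only [List.singleton_append] at h'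
      rw [h']
      rw [h] at ih
      simp at ih ⊢
      exact ih.2

lemma runs_sorted (C : List ℕ) : ∀ w ∈ runs C, w.Pairwise (· ≤ ·) := by
  induction C with
  | nil => simp [runs]
  | cons x C ih =>
    cases C with
    | nil => simp [runs]
    | cons y C =>
      rw [runs]
      have hf := runs_flatten (y :: C)
      have hn := runs_nonempty (y :: C)
      rcases hr : runs (y :: C) with _ | ⟨r, rs⟩
      · exact absurd hr (runs_ne_nil _ _)
      · rw [hr] at ih hf hn
        split_ifs with h
        · intro w hw
          simp only [List.mem_cons] at hw
          rcases hw with rfl | hw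
          · have hr0 := ih r (by simp)
            rcases r with _ | ⟨z, r⟩
            · simp
            · simp only [List.flatten_cons, List.cons_append, List.cons.injEq] at hf
              rw [List.pairwise_cons]
              refine ⟨?_, hr0⟩
              intro t ht
              simp only [List.mem_cons] at ht
              rcases ht with rfl | ht
              · omega
              · have := (List.pairwise_cons.1 hr0).1 t ht
                omega
          · exact ih w (by simp [hw])
        · intro w hw
          simp only [List.mem_cons] at hw
          rcases hw with rfl | hw
          · simp
          · exact ih w (by simpa using hw)

lemma neW_eq_self (R : List (List ℕ)) (h : ∀ w ∈ R, w ≠ []) : neW R = R := by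
  rw [neW, List.filter_eq_self]
  simpa using h

lemma runs_desc (w rest : List ℕ) (hw : w ≠ []) (hs : w.Pairwise (· ≤ ·))
    (hd : ∀ x ∈ w, ∀ y ∈ rest, y < x) : runs (w ++ rest) = w :: runs rest := by
  rcases runs_step w rest hw hs with h | ⟨r, rs, h, h'⟩
  · exact h
  · exfalso
    have h1 := runs_sorted (w ++ rest) (w ++ r) (by rw [h']; simp)
    have h2 := runs_nonempty rest r (by rw [h]; simp)
    have h3 := runs_flatten rest
    rw [h] at h3
    obtain ⟨x, hx⟩ := List.exists_mem_of_ne_nil w hw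
    obtain ⟨y, hy⟩ := List.exists_mem_of_ne_nil r h2
    have h4 := (List.pairwise_append.1 h1).2.2 x hx y hy
    have h5 := hd x hx y (by rw [← h3]; simp [hy])
    omega

lemma runs_GG (e : ℕ) (he : e ≤ 2) (he' : 1 ≤ e) (a : List ℕ) :
    compAll (runs (GG e a)) = posL a := by
  induction a with
  | nil => rfl
  | cons a0 a ih =>
    rw [GG]
    by_cases h0 : a0 = 0
    · subst h0
      simp [ih, posL]
    · rw [runs_desc]
      · have : posL (a0 :: a) = a0 :: posL a := by simp [posL, h0]
        rw [this, ← ih]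
        simp [compAll]
      · simp [h0]
      · simp
      · intro x hx y hy
        have := GG_le e he a y hy
        rw [List.mem_replicate] at hx
        omega

/-! ### Refinement -/

lemma refines_sum {β α : List ℕ} (h : Refines β α) : β.sum = α.sum := by
  obtain ⟨L, h1, h2, _⟩ := h
  rw [← h1, ← h2, List.sum_flatten]

lemma posL_sum (a : List ℕ) : (posL a).sum = a.sum := by
  induction a with
  | nil => rfl
  | cons x a ih =>
    by_cases h : x = 0
    · subst h; simp [posL] at ih ⊢; exact ih
    · simp [posL, h] at ih ⊢; exact ih

lemma refine_sorted_aux (L : List (List ℕ)) : ∀ (S R : List (List ℕ)),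
    (∀ r ∈ R, r.Pairwise (· ≤ ·)) → S.flatten = R.flatten → 
    L.flatten = compAll S → L.map List.sum = compAll R →
    ∀ w ∈ S, w.Pairwise (· ≤ ·) := by
  induction L with
  | nil =>
    intro S R hR hf hL hLR w hw
    have : S = [] := by simpa [compAll] using hL.symm
    simp [this] at hw
  | cons l L ih =>
    intro S R hR hf hL hLR
    rcases R with _ | ⟨r, R⟩
    · simp [compAll] at hLR
    · have e1 : l.sum = r.length := by simpa [compAll] using (List.cons.inj hLR).1
      have e2 : L.map List.sum = compAll R := (List.cons.inj hLR).2
      rw [List.flatten_cons] at hL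
      have hS := List.take_append_drop l.length S
      have e3 : l = compAll (S.take l.length) := by
        rw [compAll, List.map_take, ← compAll, ← hL]; simp
      have e4 : L.flatten = compAll (S.drop l.length) := by
        rw [compAll, List.map_drop, ← compAll, ← hL]; simp
      have e5 : (S.take l.length).flatten ++ (S.drop l.length).flatten = r ++ R.flatten := by
        rw [← List.flatten_append, hS, hf, List.flatten_cons]
      obtain ⟨e6, e7⟩ := List.append_inj e5 (by
        rw [List.length_flatten, ← e1]
        conv_rhs => rw [e3]
        rfl)
      intro w hw
      rw [← hS, List.mem_append] at hw
      rcases hw with hw | hw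
      · refine List.Pairwise.sublist ?_ (hR r (by simp))
        rw [← e6]
        exact List.sublist_flatten_of_mem hw
      · exact ih _ R (fun r hr => hR r (by simp [hr])) e7 e4 e2 w hw

lemma sorted_refine_aux (S : List (List ℕ)) (h0 : ∀ w ∈ S, w ≠ [])
    (h : ∀ w ∈ S, w.Pairwise (· ≤ ·)) : Refines (compAll S) (compAll (runs S.flatten)) := by
  induction S with
  | nil => exact ⟨[], by simp [compAll, runs]⟩
  | cons w S ih =>
    obtain ⟨L, h1, h2, h3⟩ := ih (fun w hw => h0 w (by simp [hw])) (fun w hw => h w (by simp [hw]))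
    rw [List.flatten_cons]
    rcases runs_step w S.flatten (h0 w (by simp)) (h w (by simp)) with hr | ⟨r, rs, hr, hr'⟩
    · rw [hr]
      exact ⟨[w.length] :: L, by simp [h1, compAll], by simp [h2, compAll], by simpa using h3⟩
    · rw [hr']
      rw [hr] at h2
      rcases L with _ | ⟨l, L⟩
      · simp [compAll] at h2
      · simp only [compAll, List.map_cons, List.cons.injEq] at h2
        refine ⟨(w.length :: l) :: L, ?_, ?_, ?_⟩
        · simp only [List.flatten_cons, compAll] at h1 ⊢
          simp [← h1]
        · simp [compAll, h2.1, h2.2]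
        · simp at h3 ⊢
          exact h3.2

lemma refines_iff (S : List (List ℕ)) :
    Refines (posL (compAll S)) (compAll (runs S.flatten)) ↔ ∀ w ∈ S, w.Pairwise (· ≤ ·) := by
  rw [posL_compAll]
  constructor
  · rintro ⟨L, h1, h2, _⟩ w hw
    by_cases hw0 : w = []
    · simp [hw0]
    · exact refine_sorted_aux L (neW S) _ (runs_sorted _)
        (by rw [flatten_neW, runs_flatten]) h1 h2 w (by simp [neW, hw, hw0])
  · intro h
    rw [← flatten_neW S]
    apply sorted_refine_aux
    · simp [neW]
    · intro w hw
      exact h w (List.mem_of_mem_filter hw)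

/-! ### Merging and bumping -/

lemma bump_head (w : List ℕ) (S : List (List ℕ)) : ∀ (r : List ℕ) (rs : List (List ℕ)),
    neW S = r :: rs → ∃ S2, S2.length = S.length ∧ neW S2 = (w ++ r) :: rs ∧
    ((w ++ r).Pairwise (· ≤ ·) → ∀ n, VV n S → VV n S2) ∧
    ∀ k, ((compAll S2).take k).sum ≤ w.length + ((compAll S).take k).sum := by
  induction S with
  | nil => intro r rs h; simp [neW] at h
  | cons u S ih =>
    intro r rs h
    by_cases hu : u = []
    · have : neW (u :: S) = neW S := by simp [neW, hu]
      rw [this] at h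
      obtain ⟨S2, h1, h2, h3, h4⟩ := ih r rs h
      refine ⟨[] :: S2, by simp [h1], by rw [← h2]; simp [neW], ?_, ?_⟩
      · intro hs n hv
        exact ⟨by simp, h3 hs _ hv.2⟩
      · intro k
        cases k with
        | zero => simp
        | succ k =>
          have := h4 k
          simp [compAll, hu] at this ⊢
          exact this
    · have : neW (u :: S) = u :: neW S := by simp [neW, hu]
      rw [this, List.cons.injEq] at h
      obtain ⟨rfl, h⟩ := h
      refine ⟨(w ++ u) :: S, by simp, by rw [← h]; simp [neW, hu], ?_, ?_⟩
      · intro hs n hv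
        refine ⟨?_, hv.2⟩
        intro x hx
        rw [List.mem_append] at hx
        rcases hx with hx | hx
        · obtain ⟨y, hy⟩ := List.exists_mem_of_ne_nil u hu
          have h4 := (List.pairwise_append.1 hs).2.2 x hx y hy
          have := hv.1 y hy
          omega
        · exact hv.1 x hx
      · intro k
        cases k with
        | zero => simp
        | succ k =>
          simp [compAll]
          omega

lemma merge_exists (S : List (List ℕ)) (h : ∀ w ∈ S, w.Pairwise (· ≤ ·)) :
    ∃ S2, neW S2 = runs S.flatten ∧ (∀ n, VV n S → VV n S2) ∧
      DomL (compAll S) (compAll S2) := by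
  induction S with
  | nil => exact ⟨[], rfl, fun _ h => h, fun _ => le_rfl⟩
  | cons w S ih =>
    obtain ⟨S2, h1, h2, h3⟩ := ih (fun w hw => h w (by simp [hw]))
    by_cases hw : w = []
    · refine ⟨[] :: S2, ?_, ?_, ?_⟩
      · simp [hw, ← h1, neW]
      · intro n hv
        exact ⟨by simp, h2 _ hv.2⟩
      · intro k
        cases k with
        | zero => simp
        | succ k =>
          have := h3 k
          simp [compAll, hw] at this ⊢
          exact this
    · rw [List.flatten_cons]
      rcases runs_step w S.flatten hw (h w (by simp)) with hr | ⟨r, rs, hr, hr'⟩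
      · refine ⟨w :: S2, ?_, ?_, ?_⟩
        · rw [hr, ← h1]; simp [neW, hw]
        · intro n hv
          exact ⟨hv.1, h2 _ hv.2⟩
        · intro k
          cases k with
          | zero => simp
          | succ k =>
            have := h3 k
            simp [compAll] at this ⊢
            exact this
      · rw [hr] at h1
        obtain ⟨S3, g1, g2, g3, g4⟩ := bump_head w S2 r rs h1
        refine ⟨[] :: S3, ?_, ?_, ?_⟩
        · rw [hr', ← g2]; simp [neW]
        · intro n hv
          refine ⟨by simp, g3 (runs_sorted (w ++ S.flatten) _ (by rw [hr']; simp)) _ (h2 _ hv.2)⟩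
        · intro k
          cases k with
          | zero => simp
          | succ k =>
            have := h3 k
            have := g4 k
            simp [compAll] at *
            omega

lemma VV_of_dom_aux (S' : List (List ℕ)) : ∀ (S : List (List ℕ)) (m n : ℕ),
    S'.flatten = S.flatten.drop m →
    (∀ k, ((compAll S).take k).sum ≤ m + ((compAll S').take k).sum) → VV n S → VV n S' := by
  induction S' with
  | nil => intros; trivial
  | cons w' S' ih =>
    intro S m n hf hk hv
    rcases S with _ | ⟨w, S⟩
    · exact VV_of_flatten_nil _ _ (by simpa using hf)
    · refine ⟨?_, ?_⟩
      · intro x hx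
        apply VV_mem _ _ hv
        apply List.mem_of_mem_drop (i := m)
        rw [← hf]; simp [hx]
      · have h1 : w.length ≤ m + w'.length := by
          have := hk 1
          simpa [compAll] using this
        apply ih S (m + w'.length - w.length) (n-1) _ _ hv.2
        · have : S'.flatten = (w :: S).flatten.drop (m + w'.length) := by
            rw [← List.drop_drop, ← hf]; simp
          rw [this, List.flatten_cons, List.drop_append]
          simp [h1]
        · intro k
          have := hk (k+1)
          simp [compAll] at this ⊢
          omega

lemma VV_of_dom (S S' : List (List ℕ)) (n : ℕ) (hf : S'.flatten = S.flatten)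
    (hd : DomL (compAll S') (compAll S)) (hv : VV n S) : VV n S' :=
  VV_of_dom_aux S' S 0 n (by simpa using hf) (by simpa [DomL] using hd) hv

lemma erase_empty (S' : List (List ℕ)) : ∀ n, VV n (neW S') → VV (n+1) S' →
    ∃ S2, VV n S2 ∧ neW S2 = neW S' ∧
      ∀ k, ((compAll S2).take k).sum ≤ ((compAll S').take (k+1)).sum := by
  induction S' with
  | nil => intro n _ _; exact ⟨[], trivial, rfl, by simp [compAll]⟩
  | cons w S ih =>
    intro n h1 h2
    by_cases hw : w = []
    · subst hw
      refine ⟨S, h2.2, by simp [neW], ?_⟩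
      intro k
      simp [compAll]
    · have : neW (w :: S) = w :: neW S := by simp [neW, hw]
      rw [this] at h1 ⊢
      have hn : 0 < n := by
        obtain ⟨y, hy⟩ := List.exists_mem_of_ne_nil w hw
        exact (h1.1 y hy).2
      have h3 : VV (n - 1 + 1) S := by
        have := h2.2
        rwa [show n - 1 + 1 = n + 1 - 1 by omega]
      obtain ⟨S2, g1, g2, g3⟩ := ih (n-1) h1.2 h3
      refine ⟨w :: S2, ⟨h1.1, g1⟩, by rw [← g2]; simp [neW, hw], ?_⟩
      intro k
      cases k with
      | zero => simp
      | succ k =>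
        have := g3 k
        simp [compAll] at this ⊢
        exact this

lemma bump_exists (n : ℕ) : ∀ R : List (List ℕ), (∀ w ∈ R, w ≠ []) → VV n R →
    ∃ S, S.length = n ∧ neW S = R ∧ VV n S ∧
      ∀ S', neW S' = R → VV n S' → DomL (compAll S') (compAll S) := by
  induction n with
  | zero =>
    intro R hR hv
    rcases R with _ | ⟨w, R⟩
    · exact ⟨[], rfl, rfl, trivial, fun S' _ _ k => by simp [compAll]⟩
    · exfalso
      obtain ⟨y, hy⟩ := List.exists_mem_of_ne_nil w (hR w (by simp))
      have := (hv.1 y hy).2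
      omega
  | succ n ih =>
    intro R hR hv
    by_cases hc : VV n R
    · obtain ⟨S, h1, h2, h3, h4⟩ := ih R hR hc
      refine ⟨[] :: S, by simp [h1], by rw [← h2]; simp [neW], ⟨by simp, h3⟩, ?_⟩
      intro S' g1 g2
      obtain ⟨S2, e1, e2, e3⟩ := erase_empty S' n (by rwa [g1]) g2
      have := h4 S2 (e2.trans g1) e1
      intro k
      cases k with
      | zero => simp
      | succ k =>
        have f1 := this k
        have f2 := e3 k
        simp only [compAll, List.map_cons, List.take_succ_cons, List.sum_cons, List.length_nil,
          zero_add] at f1 f2 ⊢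
        omega
    · rcases R with _ | ⟨r, R⟩
      · exact absurd trivial hc
      · have hr := hR r (by simp)
        obtain ⟨S, h1, h2, h3, h4⟩ := ih R (fun w hw => hR w (by simp [hw])) hv.2
        refine ⟨r :: S, by simp [h1], by rw [← h2]; simp [neW, hr], ⟨hv.1, h3⟩, ?_⟩
        intro S' g1 g2
        rcases S' with _ | ⟨w, S'⟩
        · simp [neW] at g1
        · by_cases hw : w = []
          · exfalso
            have e : neW (w :: S') = neW S' := by simp [neW, hw]
            rw [e] at g1
            apply hc
            rw [← g1]
            exact VV_neW _ _ g2.2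
          · have e : neW (w :: S') = w :: neW S' := by simp [neW, hw]
            rw [e, List.cons.injEq] at g1
            obtain ⟨rfl, g1⟩ := g1
            have := h4 S' g1 g2.2
            intro k
            cases k with
            | zero => simp
            | succ k =>
              have f1 := this k
              simp only [compAll, List.map_cons, List.take_succ_cons, List.sum_cons] at f1 ⊢
              omega

lemma dom_antisymm (c : List ℕ) : ∀ d : List ℕ, c.length = d.length → DomL c d → DomL d c →
    c = d := by
  induction c with
  | nil => intro d h _ _; exact (List.length_eq_zero_iff.1 h.symm).symm
  | cons x c ih =>
    intro d h h1 h2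
    rcases d with _ | ⟨y, d⟩
    · simp at h
    · have e : x = y := by
        have := h1 1
        have := h2 1
        simp at *
        omega
      subst e
      rw [ih d (by simpa using h) (fun k => ?_) (fun k => ?_)]
      · have := h1 (k+1)
        simpa using this
      · have := h2 (k+1)
        simpa using this

lemma split_exists (d C : List ℕ) (h : d.sum = C.length) :
    ∃ S : List (List ℕ), S.flatten = C ∧ compAll S = d := by
  induction d generalizing C with
  | nil => exact ⟨[], by simpa using (List.length_eq_zero_iff.1 (by simpa using h.symm)).symm, rfl⟩
  | cons x d ih =>
    obtain ⟨S, h1, h2⟩ := ih (C.drop x) (by simp at h ⊢; omega)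
    refine ⟨C.take x :: S, by simp [h1], ?_⟩
    simp [compAll] at h h2 ⊢
    exact ⟨by omega, h2⟩

lemma eq_of_flatten_compAll {S S' : List (List ℕ)} (h : S.flatten = S'.flatten)
    (hcomp : compAll S = compAll S') : S = S' :=
  List.eq_iff_flatten_eq.2 ⟨h, hcomp⟩

/-! ### The bijections -/

/-- Weak compositions indexing the monomials of `FSlide n a`. -/
def slideSet (n : ℕ) (a : List ℕ) : Set (List ℕ) :=
  {b | b.length = n ∧ DomL b a ∧ Refines (posL b) (posL a)}

/-- Cut shuffles. -/
def TT (n : ℕ) (a b : List ℕ) : Set (List (List ℕ)) :=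
  {S | S.length = n ∧ (∀ w ∈ S, w.Pairwise (· ≤ ·)) ∧
    S.flatten.filter (fun x => x % 2 == 1) = wordA a ∧
    S.flatten.filter (fun x => x % 2 == 0) = wordB b ∧ VV n S}

/-- Pairs of a shuffle with its bumped runs. -/
def PP (n : ℕ) (a b : List ℕ) : Set (List ℕ × List (List ℕ)) :=
  {p | InSh a b p.1 ∧ IsBumpRuns a b p.1 p.2 ∧ p.2.length = n}

lemma finite_lists (s : ℕ) : ∀ n, {l : List ℕ | l.length = n ∧ l.sum = s}.Finite := by
  intro n
  have key : ∀ n, {l : List ℕ | l.length = n ∧ ∀ x ∈ l, x ≤ s}.Finite := by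
    intro n
    induction n with
    | zero =>
      apply Set.Finite.subset (Set.finite_singleton [])
      rintro l ⟨h, _⟩
      simpa using h
    | succ n ih =>
      apply Set.Finite.subset (Set.Finite.image2 List.cons (Set.finite_Iic s) ih)
      rintro l ⟨h, h'⟩
      rcases l with _ | ⟨x, l⟩
      · simp at h
      · exact ⟨x, h' x (by simp), l, ⟨by simpa using h, fun y hy => h' y (by simp [hy])⟩, rfl⟩
  apply (key n).subset
  rintro l ⟨h, h'⟩
  refine ⟨h, fun x hx => ?_⟩
  rw [← h']
  exact List.single_le_sum (by simp) x hx

lemma slideSet_sum {n : ℕ} {a d : List ℕ} (h : d ∈ slideSet n a) : d.sum = a.sum := by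
  have := refines_sum h.2.2
  rwa [posL_sum, posL_sum] at this

lemma slideSet_finite (n : ℕ) (a : List ℕ) : (slideSet n a).Finite := by
  apply (finite_lists a.sum n).subset
  intro d hd
  exact ⟨hd.1, slideSet_sum hd⟩

lemma FSlide_eq (n : ℕ) (a : List ℕ) :
    FSlide n a = ∑ d ∈ (slideSet_finite n a).toFinset, xlist n d := by
  rw [FSlide, ← finsum_mem_eq_finite_toFinset_sum]
  rfl

/-- Membership of a cut of `GG e a` in the slide set. -/
lemma mem_slide_GG (e : ℕ) (he : e ≤ 2) (he' : 1 ≤ e) (n : ℕ) (a : List ℕ) (ha : a.length = n)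
    (O : List (List ℕ)) (hO : O.flatten = GG e a) :
    compAll O ∈ slideSet n a ↔ O.length = n ∧ VV n O ∧ ∀ w ∈ O, w.Pairwise (· ≤ ·) := by
  have h1 := dom_iff e he he' O a hO
  have h2 := refines_iff O
  rw [hO, runs_GG e he he'] at h2
  rw [slideSet, Set.mem_ofPred_eq, h1, h2, ha]
  simp [compAll]

lemma TT_maps (n : ℕ) (a b : List ℕ) (ha : a.length = n) (hb : b.length = n)
    (S : List (List ℕ)) (hS : S ∈ TT n a b) :
    compOdd S ∈ slideSet n a ∧ compEven S ∈ slideSet n b := by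
  obtain ⟨h1, h2, h3, h4, h5⟩ := hS
  rw [VV_filter] at h5
  rw [compOdd_eq, compEven_eq]
  constructor
  · rw [mem_slide_GG 1 (by norm_num) (by norm_num) n a ha]
    · refine ⟨by simp [h1], h5.1, ?_⟩
      intro w hw
      rw [List.mem_map] at hw
      obtain ⟨u, hu, rfl⟩ := hw
      exact (h2 u hu).filter _
    · rw [← wordA_eq, ← h3, List.filter_flatten]
  · rw [mem_slide_GG 2 (by norm_num) (by norm_num) n b hb]
    · refine ⟨by simp [h1], h5.2, ?_⟩
      intro w hw
      rw [List.mem_map] at hw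
      obtain ⟨u, hu, rfl⟩ := hw
      exact (h2 u hu).filter _
    · rw [← wordB_eq, ← h4, List.filter_flatten]

lemma sorted_eq (u v : List ℕ) (hu : u.Pairwise (· ≤ ·)) (hv : v.Pairwise (· ≤ ·))
    (h1 : u.filter (fun x => x % 2 == 1) = v.filter (fun x => x % 2 == 1))
    (h0 : u.filter (fun x => x % 2 == 0) = v.filter (fun x => x % 2 == 0)) : u = v := by
  have hp : u.Perm v := by
    have e : ∀ w : List ℕ, w.filter (fun x => x % 2 == 0)
        = w.filter (fun x => !(x % 2 == 1)) := by
      intro w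
      apply List.filter_congr
      intro x _
      rcases Nat.mod_two_eq_zero_or_one x with h | h <;> simp [h]
    have p1 := List.filter_append_perm (fun x => x % 2 == 1) u
    have p2 := List.filter_append_perm (fun x => x % 2 == 1) v
    rw [e, e] at h0
    rw [h1, h0] at p1
    exact p1.symm.trans p2
  exact hp.eq_of_pairwise (fun a b _ _ h h' => le_antisymm h h') hu hv

lemma words_eq (S : List (List ℕ)) : ∀ S' : List (List ℕ),
    (∀ w ∈ S, w.Pairwise (· ≤ ·)) → (∀ w ∈ S', w.Pairwise (· ≤ ·)) →
    S.map (List.filter (fun x => x % 2 == 1)) = S'.map (List.filter (fun x => x % 2 == 1)) →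
    S.map (List.filter (fun x => x % 2 == 0)) = S'.map (List.filter (fun x => x % 2 == 0)) →
    S = S' := by
  induction S with
  | nil =>
    intro S' _ _ h _
    exact (List.map_eq_nil_iff.1 h.symm).symm
  | cons w S ih =>
    intro S' h1 h2 h3 h4
    rcases S' with _ | ⟨w', S'⟩
    · simp at h3
    · simp only [List.map_cons, List.cons.injEq] at h3 h4
      rw [sorted_eq w w' (h1 w (by simp)) (h2 w' (by simp)) h3.1 h4.1,
        ih S' (fun w hw => h1 w (by simp [hw])) (fun w hw => h2 w (by simp [hw])) h3.2 h4.2]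

lemma TT_inj (n : ℕ) (a b : List ℕ) (S S' : List (List ℕ)) (hS : S ∈ TT n a b)
    (hS' : S' ∈ TT n a b) (h1 : compOdd S = compOdd S') (h2 : compEven S = compEven S') :
    S = S' := by
  apply words_eq S S' hS.2.1 hS'.2.1
  · apply eq_of_flatten_compAll
    · rw [← List.filter_flatten, ← List.filter_flatten, hS.2.2.1, hS'.2.2.1]
    · rwa [← compOdd_eq, ← compOdd_eq]
  · apply eq_of_flatten_compAll
    · rw [← List.filter_flatten, ← List.filter_flatten, hS.2.2.2.1, hS'.2.2.2.1]
    · rwa [← compEven_eq, ← compEven_eq]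

lemma merge_word (u v : List ℕ) (hu : u.Pairwise (· ≤ ·)) (hv : v.Pairwise (· ≤ ·))
    (h1 : ∀ x ∈ u, x % 2 = 1) (h0 : ∀ x ∈ v, x % 2 = 0) :
    ∃ w : List ℕ, w.Pairwise (· ≤ ·) ∧ w.filter (fun x => x % 2 == 1) = u ∧
      w.filter (fun x => x % 2 == 0) = v := by
  have hs : ((u ++ v).insertionSort (· ≤ ·)).Pairwise (· ≤ ·) :=
    List.pairwise_insertionSort _ _
  have hp := List.perm_insertionSort (· ≤ ·) (u ++ v)
  refine ⟨(u ++ v).insertionSort (· ≤ ·), hs, ?_, ?_⟩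
  · refine List.Perm.eq_of_pairwise (fun a b _ _ h h' => le_antisymm h h') (hs.filter _) hu ?_
    refine (hp.filter _).trans ?_
    rw [List.filter_append, List.filter_eq_self.2, List.filter_eq_nil_iff.2]
    · simp
    · intro x hx; simp [h0 x hx]
    · intro x hx; simp [h1 x hx]
  · refine List.Perm.eq_of_pairwise (fun a b _ _ h h' => le_antisymm h h') (hs.filter _) hv ?_
    refine (hp.filter _).trans ?_
    rw [List.filter_append, List.filter_eq_nil_iff.2, List.filter_eq_self.2]
    · simp
    · intro x hx; simp [h0 x hx]
    · intro x hx; simp [h1 x hx]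

lemma merge_words (O : List (List ℕ)) : ∀ E : List (List ℕ), O.length = E.length →
    (∀ u ∈ O, u.Pairwise (· ≤ ·)) → (∀ v ∈ E, v.Pairwise (· ≤ ·)) →
    (∀ x ∈ O.flatten, x % 2 = 1) → (∀ x ∈ E.flatten, x % 2 = 0) →
    ∃ S : List (List ℕ), (∀ w ∈ S, w.Pairwise (· ≤ ·)) ∧
      S.map (List.filter (fun x => x % 2 == 1)) = O ∧
      S.map (List.filter (fun x => x % 2 == 0)) = E := by
  induction O with
  | nil =>
    intro E h _ _ _ _
    exact ⟨[], by simp, rfl, (List.length_eq_zero_iff.1 h.symm).symm⟩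
  | cons u O ih =>
    intro E h h1 h2 h3 h4
    rcases E with _ | ⟨v, E⟩
    · simp at h
    · obtain ⟨S, g1, g2, g3⟩ := ih E (by simpa using h) (fun w hw => h1 w (by simp [hw]))
        (fun w hw => h2 w (by simp [hw]))
        (fun x hx => h3 x (by rw [List.flatten_cons]; exact List.mem_append_right _ hx))
        (fun x hx => h4 x (by rw [List.flatten_cons]; exact List.mem_append_right _ hx))
      obtain ⟨w, e1, e2, e3⟩ := merge_word u v (h1 u (by simp)) (h2 v (by simp))
        (fun x hx => h3 x (by rw [List.flatten_cons]; exact List.mem_append_left _ hx))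
        (fun x hx => h4 x (by rw [List.flatten_cons]; exact List.mem_append_left _ hx))
      refine ⟨w :: S, ?_, ?_, ?_⟩
      · intro t ht
        rw [List.mem_cons] at ht
        rcases ht with rfl | ht
        · exact e1
        · exact g1 t ht
      · rw [List.map_cons, e2, g2]
      · rw [List.map_cons, e3, g3]

lemma GG_mod (e : ℕ) (a : List ℕ) : ∀ x ∈ GG e a, x % 2 = e % 2 := by
  induction a with
  | nil => simp [GG]
  | cons a0 a ih =>
    intro x hx
    rw [GG, List.mem_append, List.mem_replicate] at hx
    rcases hx with h | h
    · omega
    · exact ih x h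

lemma TT_surj (n : ℕ) (a b : List ℕ) (ha : a.length = n) (hb : b.length = n)
    (α β : List ℕ) (hα : α ∈ slideSet n a) (hβ : β ∈ slideSet n b) :
    ∃ S ∈ TT n a b, compOdd S = α ∧ compEven S = β := by
  obtain ⟨O, hO, rfl⟩ := split_exists α (GG 1 a) (by rw [GG_length, slideSet_sum hα])
  obtain ⟨E, hE, rfl⟩ := split_exists β (GG 2 b) (by rw [GG_length, slideSet_sum hβ])
  rw [mem_slide_GG 1 (by norm_num) (by norm_num) n a ha O hO] at hα
  rw [mem_slide_GG 2 (by norm_num) (by norm_num) n b hb E hE] at hβ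
  obtain ⟨S, g1, g2, g3⟩ := merge_words O E (hα.1.trans hβ.1.symm) hα.2.2 hβ.2.2
    (by rw [hO]; exact GG_mod 1 a) (by rw [hE]; exact GG_mod 2 b)
  refine ⟨S, ⟨?_, g1, ?_, ?_, ?_⟩, ?_, ?_⟩
  · rw [← hα.1, ← g2, List.length_map]
  · rw [List.filter_flatten, g2, hO, wordA_eq]
  · rw [List.filter_flatten, g3, hE, wordB_eq]
  · rw [VV_filter, g2, g3]; exact ⟨hα.2.1, hβ.2.1⟩
  · rw [compOdd_eq, g2]
  · rw [compEven_eq, g3]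

lemma TT_finite (n : ℕ) (a b : List ℕ) (ha : a.length = n) (hb : b.length = n) :
    (TT n a b).Finite := by
  apply Set.Finite.of_injOn (f := fun S => (compOdd S, compEven S))
    (t := slideSet n a ×ˢ slideSet n b)
  · intro S hS
    exact TT_maps n a b ha hb S hS
  · intro S hS S' hS' h
    simp only [Prod.mk.injEq] at h
    exact TT_inj n a b S S' hS hS' h.1 h.2
  · exact (slideSet_finite n a).prod (slideSet_finite n b)

lemma bump_flatten {a b C : List ℕ} {S : List (List ℕ)} (h : IsBumpRuns a b C S) :
    S.flatten = C := by
  rw [← flatten_neW, ← runs_flatten C, ← h.1]; rfl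

lemma PP_mem_TT (n : ℕ) (a b : List ℕ) (ha : a.length = n) (hb : b.length = n)
    (p : List ℕ × List (List ℕ)) (hp : p ∈ PP n a b) : p.2 ∈ TT n a b := by
  obtain ⟨h1, h2, h3⟩ := hp
  have hf := bump_flatten h2
  have e1 : p.2.flatten.filter (fun x => x % 2 == 1) = wordA a := by rw [hf]; exact h1.1
  have e2 : p.2.flatten.filter (fun x => x % 2 == 0) = wordB b := by rw [hf]; exact h1.2.1
  refine ⟨h3, ?_, e1, e2, ?_⟩
  · intro w hw
    by_cases hw0 : w = []
    · simp [hw0]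
    · apply runs_sorted p.1
      rw [← h2.1]
      simp [hw, hw0]
  · exact (dom_both n a b ha hb p.2 e1 e2).1 ⟨h2.2.1, h2.2.2.1⟩

lemma PP_finite (n : ℕ) (a b : List ℕ) (ha : a.length = n) (hb : b.length = n) :
    (PP n a b).Finite := by
  apply Set.Finite.of_injOn (f := Prod.snd) (t := TT n a b)
  · intro p hp
    exact PP_mem_TT n a b ha hb p hp
  · intro p hp q hq h
    refine Prod.ext ?_ h
    rw [← bump_flatten hp.2.1, ← bump_flatten hq.2.1, h]
  · exact TT_finite n a b ha hb

lemma PP_inj (n : ℕ) (a b : List ℕ) (p q : List ℕ × List (List ℕ))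
    (hp : p ∈ PP n a b) (hq : q ∈ PP n a b) (h : p.1 = q.1) : p = q := by
  refine Prod.ext h ?_
  obtain ⟨_, hp2, hp3⟩ := hp
  obtain ⟨_, hq2, hq3⟩ := hq
  apply eq_of_flatten_compAll
  · rw [bump_flatten hp2, bump_flatten hq2, h]
  · apply dom_antisymm
    · simp [compAll, hp3, hq3]
    · exact hq2.2.2.2 p.2 (by rw [hp2.1, h]) hp2.2.1 hp2.2.2.1
    · exact hp2.2.2.2 q.2 (by rw [hq2.1, h]) hq2.2.1 hq2.2.2.1

lemma TT_PP (n : ℕ) (a b : List ℕ) (ha : a.length = n) (hb : b.length = n)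
    (S : List (List ℕ)) (hS : S ∈ TT n a b) : ∃ p ∈ PP n a b, p.1 = S.flatten := by
  obtain ⟨h1, h2, h3, h4, h5⟩ := hS
  obtain ⟨S2, g1, g2, g3⟩ := merge_exists S h2
  have hv : VV n (runs S.flatten) := by
    rw [← g1]; exact VV_neW _ _ (g2 n h5)
  obtain ⟨S3, e1, e2, e3, e4⟩ := bump_exists n (runs S.flatten) (runs_nonempty _) hv
  have key : ∀ S' : List (List ℕ), neW S' = runs S.flatten →
      ((DomL (compOdd S') a ∧ DomL (compEven S') b) ↔ VV n S') := by
    intro S' hS'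
    have hf : S'.flatten = S.flatten := by rw [← flatten_neW, hS', runs_flatten]
    apply dom_both n a b ha hb
    · rw [hf, h3]
    · rw [hf, h4]
  have k1 := (key (runs S.flatten) (neW_eq_self _ (runs_nonempty _))).2 hv
  have k2 := (key S3 e2).2 e3
  refine ⟨(S.flatten, S3), ⟨⟨h3, h4, k1.1, k1.2⟩, ⟨e2, k2.1, k2.2, ?_⟩, e1⟩, rfl⟩
  intro S' f1 f2 f3
  exact e4 S' f1 ((key S' f1).1 ⟨f2, f3⟩)

lemma fiber_maps (n : ℕ) (a b : List ℕ) (ha : a.length = n) (hb : b.length = n)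
    (p : List ℕ × List (List ℕ)) (hp : p ∈ PP n a b) (S : List (List ℕ)) (hS : S ∈ TT n a b)
    (h : S.flatten = p.1) : compAll S ∈ slideSet n (compAll p.2) := by
  obtain ⟨h1, h2, h3, h4, h5⟩ := hS
  refine ⟨by simp [compAll, h1], ?_, ?_⟩
  · obtain ⟨S2, g1, g2, g3⟩ := merge_exists S h2
    have hf : S2.flatten = S.flatten := by rw [← flatten_neW, g1, runs_flatten]
    have := (dom_both n a b ha hb S2 (by rw [hf, h3]) (by rw [hf, h4])).2 (g2 n h5)
    have h6 := hp.2.1.2.2.2 S2 (by rw [← h]; exact g1) this.1 this.2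
    exact fun k => (h6 k).trans (g3 k)
  · rw [posL_compAll p.2]
    have : neW p.2 = runs S.flatten := by rw [h]; exact hp.2.1.1
    rw [this, refines_iff]
    exact h2

lemma fiber_surj (n : ℕ) (a b : List ℕ) (ha : a.length = n) (hb : b.length = n)
    (p : List ℕ × List (List ℕ)) (hp : p ∈ PP n a b) (d : List ℕ)
    (hd : d ∈ slideSet n (compAll p.2)) :
    ∃ S ∈ TT n a b, S.flatten = p.1 ∧ compAll S = d := by
  have hpT := PP_mem_TT n a b ha hb p hp
  have hpf := bump_flatten hp.2.1
  obtain ⟨S, h1, h2⟩ := split_exists d p.1 (by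
    rw [slideSet_sum hd, ← hpf, List.length_flatten]; rfl)
  refine ⟨S, ⟨?_, ?_, ?_, ?_, ?_⟩, h1, h2⟩
  · rw [← hd.1, ← h2]; simp [compAll]
  · rw [← refines_iff]
    have := hd.2.2
    rw [posL_compAll p.2, ← h2] at this
    have e : neW p.2 = runs S.flatten := by rw [h1]; exact hp.2.1.1
    rwa [e] at this
  · rw [h1]; exact hp.1.1
  · rw [h1]; exact hp.1.2.1
  · apply VV_of_dom p.2 S n (by rw [h1, hpf]) _ hpT.2.2.2.2
    rw [h2]; exact hd.2.1

lemma xlist_mul (n : ℕ) (S : List (List ℕ)) :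
    xlist n (compOdd S) * xlist n (compEven S) = xlist n (compAll S) := by
  rw [xlist, xlist, xlist, ← Finset.prod_mul_distrib]
  apply Finset.prod_congr rfl
  intro i _
  rw [← pow_add]
  congr 1
  generalize (i : ℕ) = j
  induction S generalizing j with
  | nil => simp [compOdd, compEven, compAll]
  | cons w S ih =>
    cases j with
    | zero =>
      simp only [compOdd, compEven, compAll, List.map_cons, List.getD_cons_zero]
      rw [List.length_eq_length_filter_add (l := w) (fun x => x % 2 == 1)]
      congr 2
      apply List.filter_congr
      intro x _
      rcases Nat.mod_two_eq_zero_or_one x with h | h <;> simp [h]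
    | succ j => simpa [compOdd, compEven, compAll] using ih j

lemma lhs_eq (n : ℕ) (a b : List ℕ) (ha : a.length = n) (hb : b.length = n) :
    FSlide n a * FSlide n b =
      ∑ S ∈ (TT_finite n a b ha hb).toFinset, xlist n (compAll S) := by
  rw [FSlide_eq, FSlide_eq, Finset.sum_mul_sum, ← Finset.sum_product']
  symm
  apply Finset.sum_bij (fun S _ => (compOdd S, compEven S))
  · intro S hS
    simp only [Set.Finite.mem_toFinset, Finset.mem_product] at hS ⊢
    exact TT_maps n a b ha hb S hS
  · intro S hS S' hS' h
    simp only [Set.Finite.mem_toFinset] at hS hS'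
    simp only [Prod.mk.injEq] at h
    exact TT_inj n a b S S' hS hS' h.1 h.2
  · rintro ⟨α, β⟩ h
    simp only [Set.Finite.mem_toFinset, Finset.mem_product] at h
    obtain ⟨S, h1, h2, h3⟩ := TT_surj n a b ha hb α β h.1 h.2
    exact ⟨S, by simpa using h1, by rw [h2, h3]⟩
  · intro S _
    exact (xlist_mul n S).symm

lemma fiber_sum (n : ℕ) (a b : List ℕ) (ha : a.length = n) (hb : b.length = n)
    (p : List ℕ × List (List ℕ)) (hp : p ∈ PP n a b) :
    FSlide n (compAll p.2) =
      ∑ S ∈ (TT_finite n a b ha hb).toFinset with S.flatten = p.1, xlist n (compAll S) := by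
  rw [FSlide_eq]
  symm
  apply Finset.sum_bij (fun S _ => compAll S)
  · intro S hS
    simp only [Set.Finite.mem_toFinset, Finset.mem_filter] at hS ⊢
    exact fiber_maps n a b ha hb p hp S hS.1 hS.2
  · intro S hS S' hS' h
    simp only [Set.Finite.mem_toFinset, Finset.mem_filter] at hS hS'
    exact eq_of_flatten_compAll (hS.2.trans hS'.2.symm) h
  · intro d hd
    simp only [Set.Finite.mem_toFinset] at hd
    obtain ⟨S, h1, h2, h3⟩ := fiber_surj n a b ha hb p hp d hd
    exact ⟨S, by simp [h1, h2], h3⟩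
  · intro S _
    rfl

lemma TT_sum_eq (n : ℕ) (a b : List ℕ) (ha : a.length = n) (hb : b.length = n) :
    ∑ S ∈ (TT_finite n a b ha hb).toFinset, xlist n (compAll S) =
      ∑ p ∈ (PP_finite n a b ha hb).toFinset, FSlide n (compAll p.2) := by
  classical
  rw [Finset.sum_congr rfl (fun p hp => fiber_sum n a b ha hb p (by simpa using hp))]
  rw [← Finset.sum_fiberwise_of_maps_to (g := List.flatten)
    (t := (PP_finite n a b ha hb).toFinset.image Prod.fst)]
  · rw [Finset.sum_image]
    intro p hp q hq h
    simp only [Finset.mem_coe, Set.Finite.mem_toFinset] at hp hq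
    exact PP_inj n a b p q hp hq h
  · intro S hS
    simp only [Set.Finite.mem_toFinset] at hS
    obtain ⟨p, h1, h2⟩ := TT_PP n a b ha hb S hS
    rw [Finset.mem_image]
    exact ⟨p, by simpa using h1, h2⟩

lemma slideMult_eq (n : ℕ) (a b : List ℕ) (ha : a.length = n) (hb : b.length = n)
    (c : List ℕ) (hc : c.length = n) :
    slideMult a b c = ((PP_finite n a b ha hb).toFinset.filter (fun p => compAll p.2 = c)).card := by
  rw [slideMult]
  apply Nat.subtype_card
  intro p
  simp only [Finset.mem_filter, Set.Finite.mem_toFinset, PP, Set.mem_ofPred_eq]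
  constructor
  · rintro ⟨⟨h1, h2, h3⟩, h4⟩
    exact ⟨h1, h2, h4⟩
  · rintro ⟨h1, h2, h4⟩
    refine ⟨⟨h1, h2, ?_⟩, h4⟩
    rw [← hc, ← h4]; simp [compAll]

/-- For weak compositions `a`, `b` (of length `n`), the product of fundamental slide
polynomials is `𝔉_a · 𝔉_b = ∑_c C_{a,b}^c 𝔉_c`, where `C_{a,b}^c` is the multiplicity of
`c` in the slide product `a ⧢ b`.  In particular the fundamental slide basis has
nonnegative integer structure coefficients. -/
theorem fslide_mult (n : ℕ) (a b : List ℕ) (ha : a.length = n) (hb : b.length = n) :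
    FSlide n a * FSlide n b =
      ∑ᶠ (c : List ℕ) (_ : c.length = n), (slideMult a b c : ℤ) • FSlide n c := by
  classical
  rw [lhs_eq n a b ha hb, TT_sum_eq n a b ha hb]
  have hlen : ∀ p ∈ (PP_finite n a b ha hb).toFinset, (compAll p.2).length = n := by
    intro p hp
    rw [Set.Finite.mem_toFinset] at hp
    simpa [compAll] using hp.2.2
  refine Eq.trans ?_ (finsum_mem_eq_sum_of_inter_support_eq
    (f := fun c => (slideMult a b c : ℤ) • FSlide n c)
    (s := {c : List ℕ | c.length = n})
    (t := (PP_finite n a b ha hb).toFinset.image (fun p => compAll p.2)) ?_).symm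
  · rw [← Finset.sum_fiberwise_of_maps_to (g := fun p => compAll p.2)
      (t := (PP_finite n a b ha hb).toFinset.image (fun p => compAll p.2))
      (fun p hp => Finset.mem_image_of_mem _ hp)]
    apply Finset.sum_congr rfl
    intro c hc
    rw [Finset.mem_image] at hc
    obtain ⟨q, hq, rfl⟩ := hc
    rw [slideMult_eq n a b ha hb _ (hlen q hq)]
    rw [Finset.sum_congr rfl (g := fun _ => FSlide n (compAll q.2))
      (fun p hp => by rw [(Finset.mem_filter.1 hp).2])]
    rw [Finset.sum_const, natCast_zsmul]
  · ext c
    simp only [Set.mem_inter_iff, Set.mem_ofPred_eq, Function.mem_support, Finset.mem_coe,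
      Finset.mem_image]
    constructor
    · rintro ⟨h1, h2⟩
      refine ⟨?_, h2⟩
      by_contra hne
      apply h2
      rw [slideMult_eq n a b ha hb c h1, Finset.filter_eq_empty_iff.2, Finset.card_empty]
      · simp
      · intro p hp hpc
        exact hne ⟨p, hp, hpc⟩
    · rintro ⟨⟨p, hp, rfl⟩, h2⟩
      exact ⟨hlen p hp, h2⟩
end
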